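/- arXiv:2301.06220 — 9 statements merged into one kernel-verified Lean document; each statement's English description precedes it below -/
import Mathlib

section
/- Let X be a Hausdorff topological space. Then |X| ≤ |RO(X)|^{wψc(X)} (cardinal exponentiation), where |RO(X)| is the cardinality of the collection of regular open subsets of X. -/
open Set TopologicalSpace Cardinal

universe u

variable (X : Type u) [TopologicalSpace X]

/-- The density `d(X)`: the least infinite cardinal `κ` such that `X` has a dense
subset of cardinality at most `κ`. -/
noncomputable def density : Cardinal.{u} :=
  sInf {κ : Cardinal.{u} | ℵ₀ ≤ κ ∧ ∃ D : Set X, Dense D ∧ #D ≤ κ}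

/-- The cellularity `c(X)`: the least infinite cardinal `κ` such that every pairwise
disjoint family of nonempty open subsets of `X` has cardinality at most `κ`. -/
noncomputable def cellularity : Cardinal.{u} :=
  sInf {κ : Cardinal.{u} | ℵ₀ ≤ κ ∧ ∀ 𝒰 : Set (Set X),
    (∀ U ∈ 𝒰, IsOpen U ∧ U.Nonempty) → (𝒰.Pairwise fun U V => U ∩ V = ∅) → #𝒰 ≤ κ}

/-- The π-character of a point `x`: the least infinite cardinal `κ` such that `x`
has a local π-base of cardinality at most `κ`. -/
noncomputable def piCharAt (x : X) : Cardinal.{u} :=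
  sInf {κ : Cardinal.{u} | ℵ₀ ≤ κ ∧ ∃ ℬ : Set (Set X),
    (∀ B ∈ ℬ, IsOpen B ∧ B.Nonempty) ∧
    (∀ U : Set X, IsOpen U → x ∈ U → ∃ B ∈ ℬ, B ⊆ U) ∧ #ℬ ≤ κ}

/-- The π-character `πχ(X)`: the supremum over `x ∈ X` of `piCharAt X x`. -/
noncomputable def piChar : Cardinal.{u} := ⨆ x : X, piCharAt X x

/-- The π-weight `πw(X)`: the least infinite cardinal `κ` such that `X` has a π-base
of cardinality at most `κ`. -/
noncomputable def piWeight : Cardinal.{u} :=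
  sInf {κ : Cardinal.{u} | ℵ₀ ≤ κ ∧ ∃ ℬ : Set (Set X),
    (∀ B ∈ ℬ, IsOpen B ∧ B.Nonempty) ∧
    (∀ U : Set X, IsOpen U → U.Nonempty → ∃ B ∈ ℬ, B ⊆ U) ∧ #ℬ ≤ κ}

/-- The closed pseudocharacter `ψc(x, X)` of a point `x`: the least infinite cardinal
`κ` such that there is a family `𝒱` of open sets, each containing `x`, with `|𝒱| ≤ κ`
and `{x} = ⋂ 𝒱 = ⋂_{V ∈ 𝒱} cl V`. -/
noncomputable def closedPseudoCharAt (x : X) : Cardinal.{u} :=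
  sInf {κ : Cardinal.{u} | ℵ₀ ≤ κ ∧ ∃ 𝒱 : Set (Set X),
    (∀ V ∈ 𝒱, IsOpen V ∧ x ∈ V) ∧ #𝒱 ≤ κ ∧
    ({x} : Set X) = ⋂₀ 𝒱 ∧ ({x} : Set X) = ⋂ V ∈ 𝒱, closure V}

/-- The dense closed pseudocharacter `dψc(X)`: the least infinite cardinal `κ` such
that `X` has a dense subset `D` with `ψc(d, X) ≤ κ` for every `d ∈ D`. -/
noncomputable def densePsiC : Cardinal.{u} :=
  sInf {κ : Cardinal.{u} | ℵ₀ ≤ κ ∧ ∃ D : Set X, Dense D ∧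
    ∀ d ∈ D, closedPseudoCharAt X d ≤ κ}

/-- The weak closed pseudocharacter of a point `x`: the least infinite cardinal `κ`
such that there is a family `𝒱` of open sets (not necessarily containing `x`) with
`|𝒱| ≤ κ` and `{x} = ⋂_{V ∈ 𝒱} cl V`. -/
noncomputable def weakPsiCAt (x : X) : Cardinal.{u} :=
  sInf {κ : Cardinal.{u} | ℵ₀ ≤ κ ∧ ∃ 𝒱 : Set (Set X),
    (∀ V ∈ 𝒱, IsOpen V) ∧ (({x} : Set X) = ⋂ V ∈ 𝒱, closure V) ∧ #𝒱 ≤ κ}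

/-- The weak closed pseudocharacter `wψc(X)`: the supremum over `x ∈ X`. -/
noncomputable def weakPsiC : Cardinal.{u} := ⨆ x : X, weakPsiCAt X x

/-- The q-pseudocharacter of a point `x`: the least infinite cardinal `κ` such that
`x` has a q-pseudobase of cardinality at most `κ`, i.e. a family `ℬ` of nonempty open
sets such that for every `y ≠ x` there is `𝒞 ⊆ ℬ` with `x ∈ cl (⋃ 𝒞)` and
`y ∉ cl (⋃ 𝒞)`. -/
noncomputable def qPsiAt (x : X) : Cardinal.{u} :=
  sInf {κ : Cardinal.{u} | ℵ₀ ≤ κ ∧ ∃ ℬ : Set (Set X),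
    (∀ B ∈ ℬ, IsOpen B ∧ B.Nonempty) ∧ #ℬ ≤ κ ∧
    ∀ y : X, y ≠ x → ∃ 𝒞 ⊆ ℬ, x ∈ closure (⋃₀ 𝒞) ∧ y ∉ closure (⋃₀ 𝒞)}

/-- The q-pseudocharacter `qψ(X)`: the supremum over `x ∈ X`. -/
noncomputable def qPsi : Cardinal.{u} := ⨆ x : X, qPsiAt X x

/-- The o-tightness `ot(X)`: the least infinite cardinal `κ` such that whenever
`x ∈ cl (⋃ 𝒰)` for a family `𝒰` of open sets, there is `𝒱 ⊆ 𝒰` with `|𝒱| ≤ κ`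
and `x ∈ cl (⋃ 𝒱)`. -/
noncomputable def oTightness : Cardinal.{u} :=
  sInf {κ : Cardinal.{u} | ℵ₀ ≤ κ ∧ ∀ (x : X) (𝒰 : Set (Set X)),
    (∀ U ∈ 𝒰, IsOpen U) → x ∈ closure (⋃₀ 𝒰) →
    ∃ 𝒱 ⊆ 𝒰, #𝒱 ≤ κ ∧ x ∈ closure (⋃₀ 𝒱)}

/-- The dense o-tightness `dot(X)`: the least infinite cardinal `κ` such that whenever
`𝒰` is a family of open sets with `⋃ 𝒰` dense in `X` and `x ∈ X`, there is `𝒱 ⊆ 𝒰`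
with `|𝒱| ≤ κ` and `x ∈ cl (⋃ 𝒱)`. -/
noncomputable def denseOTightness : Cardinal.{u} :=
  sInf {κ : Cardinal.{u} | ℵ₀ ≤ κ ∧ ∀ (x : X) (𝒰 : Set (Set X)),
    (∀ U ∈ 𝒰, IsOpen U) → Dense (⋃₀ 𝒰) →
    ∃ 𝒱 ⊆ 𝒰, #𝒱 ≤ κ ∧ x ∈ closure (⋃₀ 𝒱)}

/-- A space is quasiregular if every nonempty open set contains the closure of some
nonempty open set. -/
def QuasiRegular : Prop :=
  ∀ U : Set X, IsOpen U → U.Nonempty → ∃ V : Set X, IsOpen V ∧ V.Nonempty ∧ closure V ⊆ U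

/-- The collection `RO(X)` of regular open subsets of `X`. -/
def regularOpens : Set (Set X) := {U : Set X | U = interior (closure U)}

theorem weakPsiC_family (X : Type u) [TopologicalSpace X] [T2Space X] (x : X) :
    ∃ 𝒱 : Set (Set X), (∀ V ∈ 𝒱, IsOpen V) ∧ (({x} : Set X) = ⋂ V ∈ 𝒱, closure V) ∧
      #𝒱 ≤ weakPsiCAt X x := by
  have hne : {κ : Cardinal.{u} | ℵ₀ ≤ κ ∧ ∃ 𝒱 : Set (Set X),
    (∀ V ∈ 𝒱, IsOpen V) ∧ (({x} : Set X) = ⋂ V ∈ 𝒱, closure V) ∧ #𝒱 ≤ κ}.Nonempty := by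
    refine ⟨max ℵ₀ #({V : Set X | IsOpen V ∧ x ∈ V} : Set (Set X)), le_max_left _ _,
      {V : Set X | IsOpen V ∧ x ∈ V}, fun V hV => hV.1, ?_, le_max_right _ _⟩
    apply Subset.antisymm
    · rintro y rfl
      simp only [mem_iInter]
      exact fun V hV => subset_closure hV.2
    · intro y hy
      by_contra hyx
      obtain ⟨U, V, hU, hV, hxU, hyV, hd⟩ := t2_separation (fun h : x = y => hyx h.symm)
      simp only [mem_iInter] at hy
      exact (hd.closure_left hV).le_bot ⟨hy U ⟨hU, hxU⟩, hyV⟩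
  exact (csInf_mem hne).2

theorem stmt_4 (X : Type u) [TopologicalSpace X] [T2Space X] :
    #X ≤ #(regularOpens X) ^ weakPsiC X := by
  have key : ∀ x : X, ∃ f : (weakPsiC X).out → regularOpens X,
      ({x} : Set X) = ⋂ k, closure (f k : Set X) := by
    intro x
    obtain ⟨𝒱, ho, hx, hc⟩ := weakPsiC_family X x
    have hle : #𝒱 ≤ #(weakPsiC X).out := by
      rw [mk_out]
      exact hc.trans (le_ciSup (Cardinal.bddAbove_range (weakPsiCAt X)) x)
    obtain ⟨e⟩ := hle
    have hreg : ∀ V : 𝒱, interior (closure (V : Set X)) ∈ regularOpens X := fun V =>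
      (interior_closure_idem (s := (V : Set X))).symm
    have hcl : ∀ V : 𝒱, closure (interior (closure (V : Set X))) = closure (V : Set X) := by
      intro V
      apply Subset.antisymm
      · exact closure_minimal interior_subset isClosed_closure
      · exact closure_mono (interior_maximal subset_closure (ho V V.2))
    have huniv : (univ : Set X) ∈ regularOpens X := by simp [regularOpens]
    refine ⟨Function.extend e (fun V => ⟨_, hreg V⟩) (fun _ => ⟨univ, huniv⟩), ?_⟩
    rw [hx]
    apply Subset.antisymm
    · intro y hy
      simp only [mem_iInter] at hy ⊢
      intro k
      by_cases hk : ∃ V, e V = k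
      · obtain ⟨V, rfl⟩ := hk
        rw [e.injective.extend_apply]
        simpa only [hcl V] using hy V V.2
      · rw [Function.extend_apply' _ _ _ hk]
        simp
    · intro y hy
      simp only [mem_iInter] at hy ⊢
      intro V hV
      have := hy (e ⟨V, hV⟩)
      rw [e.injective.extend_apply] at this
      simpa only [hcl ⟨V, hV⟩] using this
  choose f hf using key
  have hinj : Function.Injective f := by
    intro x y h
    have : ({x} : Set X) = {y} := by rw [hf x, hf y, h]
    exact singleton_injective this
  have := mk_le_of_injective hinj
  rwa [← Cardinal.power_def, mk_out] at this
end

section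
/- Let X be a quasiregular Hausdorff topological space. Then |X| ≤ πχ(X)^{c(X)·wψc(X)} (cardinal exponentiation, with product of cardinals in the exponent). -/
open Set TopologicalSpace Cardinal

universe u

variable (X : Type u) [TopologicalSpace X]

theorem cell_spec (X : Type u) [TopologicalSpace X] :
    ℵ₀ ≤ cellularity X ∧ ∀ 𝒰 : Set (Set X),
    (∀ U ∈ 𝒰, IsOpen U ∧ U.Nonempty) → (𝒰.Pairwise fun U V => U ∩ V = ∅) →
      #𝒰 ≤ cellularity X := by
  have := csInf_mem (s := {κ : Cardinal.{u} | ℵ₀ ≤ κ ∧ ∀ 𝒰 : Set (Set X),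
    (∀ U ∈ 𝒰, IsOpen U ∧ U.Nonempty) → (𝒰.Pairwise fun U V => U ∩ V = ∅) → #𝒰 ≤ κ})
    ⟨ℵ₀ + #(Set X), self_le_add_right _ _, fun 𝒰 _ _ => (mk_set_le 𝒰).trans (self_le_add_left _ _)⟩
  exact this

theorem piCharAt_spec (X : Type u) [TopologicalSpace X] (x : X) :
    ℵ₀ ≤ piCharAt X x ∧ ∃ ℬ : Set (Set X),
    (∀ B ∈ ℬ, IsOpen B ∧ B.Nonempty) ∧
    (∀ U : Set X, IsOpen U → x ∈ U → ∃ B ∈ ℬ, B ⊆ U) ∧ #ℬ ≤ piCharAt X x := by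
  have := csInf_mem (s := {κ : Cardinal.{u} | ℵ₀ ≤ κ ∧ ∃ ℬ : Set (Set X),
    (∀ B ∈ ℬ, IsOpen B ∧ B.Nonempty) ∧
    (∀ U : Set X, IsOpen U → x ∈ U → ∃ B ∈ ℬ, B ⊆ U) ∧ #ℬ ≤ κ})
    ⟨ℵ₀ + #(Set X), self_le_add_right _ _, {B | IsOpen B ∧ B.Nonempty}, fun B h => h,
      fun U hU hx => ⟨U, ⟨hU, x, hx⟩, subset_rfl⟩, (mk_set_le _).trans (self_le_add_left _ _)⟩
  exact this

theorem weakPsiCAt_spec (X : Type u) [TopologicalSpace X] [T2Space X] (x : X) :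
    ℵ₀ ≤ weakPsiCAt X x ∧ ∃ 𝒱 : Set (Set X),
    (∀ V ∈ 𝒱, IsOpen V) ∧ (({x} : Set X) = ⋂ V ∈ 𝒱, closure V) ∧ #𝒱 ≤ weakPsiCAt X x := by
  have := csInf_mem (s := {κ : Cardinal.{u} | ℵ₀ ≤ κ ∧ ∃ 𝒱 : Set (Set X),
    (∀ V ∈ 𝒱, IsOpen V) ∧ (({x} : Set X) = ⋂ V ∈ 𝒱, closure V) ∧ #𝒱 ≤ κ})
    ⟨ℵ₀ + #(Set X), self_le_add_right _ _, {B | IsOpen B ∧ x ∈ B}, fun B h => h.1, ?_,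
      (mk_set_le _).trans (self_le_add_left _ _)⟩
  · exact this
  · ext y
    simp only [mem_singleton_iff, mem_iInter, mem_ofPred_eq]
    constructor
    · rintro rfl V hV
      exact subset_closure hV.2
    · intro h
      by_contra hne
      obtain ⟨U, V, hU, hV, hyU, hxV, hd⟩ := t2_separation hne
      obtain ⟨z, hz⟩ := mem_closure_iff.1 (h V ⟨hV, hxV⟩) U hU hyU
      exact disjoint_left.1 hd hz.1 hz.2

theorem exists_surj {P α : Type u} [Nonempty α] (h : #α ≤ #P) :
    ∃ f : P → α, Function.Surjective f := by
  obtain ⟨g⟩ := Cardinal.le_def _ _ |>.1 h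
  exact ⟨Function.invFun g, Function.invFun_surjective g.injective⟩

theorem cell_sub (X : Type u) [TopologicalSpace X] {ι T : Type u} (hι : cellularity X ≤ #ι)
    (G : T → Set X) (hG : ∀ t, IsOpen (G t)) (S : Set T) (hne : (⋃ t ∈ S, G t).Nonempty) :
    ∃ s : ι → T, (∀ i, s i ∈ S) ∧ (⋃ t ∈ S, G t) ⊆ closure (⋃ i, G (s i)) := by
  obtain ⟨D, hD⟩ := zorn_subset
    {D : Set (Set X) | (∀ U ∈ D, (IsOpen U ∧ U.Nonempty) ∧ ∃ t ∈ S, U ⊆ G t) ∧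
      D.Pairwise fun U V => U ∩ V = ∅} (by
    intro c hc hch
    refine ⟨⋃₀ c, ⟨?_, ?_⟩, fun s hs => subset_sUnion_of_mem hs⟩
    · rintro U ⟨d, hd, hU⟩
      exact (hc hd).1 U hU
    · exact (pairwise_sUnion hch.directedOn).2 fun d hd => (hc hd).2)
  obtain ⟨⟨hD1, hD2⟩, hmax⟩ := hD
  have key : (⋃ t ∈ S, G t) ⊆ closure (⋃₀ D) := by
    intro x hx
    by_contra hxn
    obtain ⟨t, ht, hxt⟩ := mem_iUnion₂.1 hx
    set N := G t ∩ (closure (⋃₀ D))ᶜ with hN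
    have hNo : IsOpen N := (hG t).inter isClosed_closure.isOpen_compl
    have hdis : ∀ U ∈ D, N ∩ U = ∅ := by
      intro U hU
      ext z
      simp only [mem_inter_iff, mem_empty_iff_false, iff_false]
      rintro ⟨hz, hzU⟩
      exact hz.2 (subset_closure ⟨U, hU, hzU⟩)
    have hmem : N ∈ D := by
      apply hmax (y := insert N D) _ (subset_insert _ _) (mem_insert _ _)
      refine ⟨?_, ?_⟩
      · rintro U (rfl | hU)
        · exact ⟨⟨hNo, x, hxt, hxn⟩, t, ht, inter_subset_left⟩
        · exact hD1 U hU
      · apply hD2.insert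
        intro U hU _
        exact ⟨hdis U hU, by rw [inter_comm]; exact hdis U hU⟩
    exact hxn (subset_closure ⟨N, hmem, hxt, hxn⟩)
  have hDne : Nonempty D := by
    by_contra hcon
    have : D = ∅ := by
      by_contra h
      obtain ⟨d, hd⟩ := nonempty_iff_ne_empty.2 h
      exact hcon ⟨d, hd⟩
    obtain ⟨x, hx⟩ := hne
    simpa [this] using key hx
  have hcard : #D ≤ #ι := ((cell_spec X).2 D (fun U hU => (hD1 U hU).1) hD2).trans hι
  obtain ⟨f, hf⟩ := exists_surj hcard
  choose τ hτ hτ' using fun d : D => (hD1 d d.2).2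
  refine ⟨fun i => τ (f i), fun i => hτ _, key.trans (closure_mono ?_)⟩
  rintro z ⟨d, hd, hz⟩
  obtain ⟨i, hi⟩ := hf ⟨d, hd⟩
  refine mem_iUnion.2 ⟨i, hτ' _ ?_⟩
  rw [hi]; exact hz

/-- arities for the closing-off construction -/
def arity (ι P : Type u) : Option (ι → P) → Type u
  | none => PEmpty
  | some _ => ι

theorem card_W (ι P : Type u) (hι : ℵ₀ ≤ #ι) (hP : ℵ₀ ≤ #P) :
    #(WType (arity ι P)) ≤ #P ^ #ι := by
  have h1 : ℵ₀ ≤ #P ^ #ι := hP.trans (self_le_power _ (one_le_aleph0.trans hι))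
  have hpow : (#P ^ #ι) ^ #ι = #P ^ #ι := by
    rw [← power_mul, mul_eq_self hι]
  apply WType.cardinalMk_le_of_le
  calc Cardinal.sum (fun a => (#P ^ #ι) ^ #(arity ι P a))
      ≤ Cardinal.sum (fun _ : Option (ι → P) => #P ^ #ι) := by
        apply Cardinal.sum_le_sum
        rintro (_ | a)
        · simp only [arity, mk_pempty, power_zero]
          exact one_le_aleph0.trans h1
        · simp only [arity]
          exact hpow.le
    _ = (#P ^ #ι + 1) * #P ^ #ι := by simp
    _ ≤ #P ^ #ι := by
        rw [add_one_eq h1, mul_eq_self h1]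

theorem exists_small_pibase (X : Type u) [TopologicalSpace X] (hqr : QuasiRegular X)
    (ι P : Type u) (hι : cellularity X ≤ #ι) (hP : ℵ₀ ≤ #P) (hPx : ∀ x, piCharAt X x ≤ #P)
    (x0 : X) :
    ∃ (T : Type u) (E : T → Set X), #T ≤ #P ^ #ι ∧
      ∀ V, IsOpen V → V.Nonempty → ∃ s : ι → T, closure V = closure (⋃ i, E (s i)) := by
  classical
  have hι0 : ℵ₀ ≤ #ι := (cell_spec X).1.trans hι
  have he : ∀ x : X, ∃ e : P → Set X, (∀ p, IsOpen (e p) ∧ (e p).Nonempty) ∧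
      ∀ U : Set X, IsOpen U → x ∈ U → ∃ p, e p ⊆ U := by
    intro x
    obtain ⟨_, B, hB1, hB2, hB3⟩ := piCharAt_spec X x
    obtain ⟨b, hb, _⟩ := hB2 univ isOpen_univ trivial
    have : Nonempty B := ⟨⟨b, hb⟩⟩
    obtain ⟨f, hf⟩ := exists_surj (hB3.trans (hPx x))
    refine ⟨fun p => f p, fun p => hB1 _ (f p).2, fun U hU hx => ?_⟩
    obtain ⟨b, hb, hbU⟩ := hB2 U hU hx
    obtain ⟨p, hp⟩ := hf ⟨b, hb⟩
    exact ⟨p, by simpa only [hp] using hbU⟩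
  choose e he1 he2 using he
  have hF : ∀ (p : ι → P) (y : ι → X), ∃ z : X,
      ((closure (⋃ i, e (y i) (p i)))ᶜ).Nonempty → z ∈ (closure (⋃ i, e (y i) (p i)))ᶜ := by
    intro p y
    by_cases h : ((closure (⋃ i, e (y i) (p i)))ᶜ).Nonempty
    · exact ⟨h.some, fun _ => h.some_mem⟩
    · exact ⟨x0, fun h' => absurd h' h⟩
  choose F hF using hF
  let g : (Σ a : Option (ι → P), arity ι P a → X) → X := fun q =>
    match q with
    | ⟨none, _⟩ => x0
    | ⟨some p, y⟩ => F p y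
  let pt : WType (arity ι P) → X := WType.elim X g
  have hpt : ∀ (p : ι → P) (w : ι → WType (arity ι P)),
      ∃ v, pt v = F p (fun i => pt (w i)) := fun p w => ⟨WType.mk (some p) w, rfl⟩
  let w0 : WType (arity ι P) := WType.mk none PEmpty.elim
  let E : WType (arity ι P) × P → Set X := fun t => e (pt t.1) t.2
  have hEo : ∀ t, IsOpen (E t) := fun t => (he1 _ _).1
  have hdense : ∀ V, IsOpen V → V.Nonempty → ∃ w, pt w ∈ V := by
    intro V hV hVne
    by_contra! hcon
    obtain ⟨V0, hV0, hV0ne, hV0V⟩ := hqr V hV hVne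
    let S : Set (WType (arity ι P) × P) := {t | E t ⊆ V0ᶜ}
    have hin : ∀ w, pt w ∈ closure (⋃ t ∈ S, E t) := by
      intro w
      rw [mem_closure_iff]
      intro N hN hw
      obtain ⟨p, hp⟩ := he2 (pt w) (N ∩ (closure V0)ᶜ)
        (hN.inter isClosed_closure.isOpen_compl) ⟨hw, fun h => hcon w (hV0V h)⟩
      obtain ⟨z, hz⟩ := (he1 (pt w) p).2
      refine ⟨z, (hp hz).1, mem_iUnion₂.2 ⟨(w, p), ?_, hz⟩⟩
      intro y hy hy0
      exact (hp hy).2 (subset_closure hy0)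
    have hne : (⋃ t ∈ S, E t).Nonempty := closure_nonempty_iff.1 ⟨_, hin w0⟩
    obtain ⟨s, hsS, hs⟩ := cell_sub X hι E hEo S hne
    obtain ⟨v, hv⟩ := hpt (fun i => (s i).2) (fun i => (s i).1)
    have h1 : pt v ∈ closure (⋃ i, E (s i)) :=
      closure_minimal hs isClosed_closure (hin v)
    obtain ⟨z, hz⟩ := hV0ne
    have h2 := hF (fun i => (s i).2) (fun i => pt (s i).1) ⟨z, by
      intro hzc
      obtain ⟨y, hy0, hy⟩ := mem_closure_iff.1 hzc V0 hV0 hz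
      obtain ⟨i, hi⟩ := mem_iUnion.1 hy
      exact hsS i hi hy0⟩
    rw [← hv] at h2
    exact h2 h1
  refine ⟨WType (arity ι P) × P, E, ?_, ?_⟩
  · have h1 : ℵ₀ ≤ #P ^ #ι := hP.trans (self_le_power _ (one_le_aleph0.trans hι0))
    rw [mk_prod, lift_id, lift_id]
    calc _ ≤ #P ^ #ι * #P ^ #ι :=
          mul_le_mul' (card_W ι P hι0 hP) (self_le_power _ (one_le_aleph0.trans hι0))
      _ = _ := mul_eq_self h1
  · intro V hV hVne
    let S : Set (WType (arity ι P) × P) := {t | E t ⊆ V}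
    have hsub : V ⊆ closure (⋃ t ∈ S, E t) := by
      intro y hy
      rw [mem_closure_iff]
      intro N hN hyN
      obtain ⟨w, hw⟩ := hdense (N ∩ V) (hN.inter hV) ⟨y, hyN, hy⟩
      obtain ⟨p, hp⟩ := he2 (pt w) (N ∩ V) (hN.inter hV) hw
      obtain ⟨z, hz⟩ := (he1 (pt w) p).2
      exact ⟨z, (hp hz).1, mem_iUnion₂.2 ⟨(w, p), fun y hy => (hp hy).2, hz⟩⟩
    have hne : (⋃ t ∈ S, E t).Nonempty := closure_nonempty_iff.1 (hVne.mono hsub)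
    obtain ⟨s, hsS, hs⟩ := cell_sub X hι E hEo S hne
    refine ⟨s, subset_antisymm ?_ (closure_mono (iUnion_subset fun i => hsS i))⟩
    exact closure_minimal (hsub.trans (closure_minimal hs isClosed_closure)) isClosed_closure

theorem stmt_5 (X : Type u) [TopologicalSpace X] [T2Space X] (hqr : QuasiRegular X) :
    #X ≤ piChar X ^ (cellularity X * weakPsiC X) := by
  rcases isEmpty_or_nonempty X with hX | ⟨⟨x0⟩⟩
  · simp
  have hPx : ∀ x, piCharAt X x ≤ piChar X := le_ciSup bddAbove_of_small
  have hWx : ∀ x, weakPsiCAt X x ≤ weakPsiC X := le_ciSup bddAbove_of_small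
  have hP : ℵ₀ ≤ piChar X := (piCharAt_spec X x0).1.trans (hPx x0)
  have hW : ℵ₀ ≤ weakPsiC X := (weakPsiCAt_spec X x0).1.trans (hWx x0)
  have hc : ℵ₀ ≤ cellularity X := (cell_spec X).1
  obtain ⟨T, E, hT, hE⟩ := exists_small_pibase X hqr (cellularity X).out (piChar X).out
    (by simp) (by simpa using hP) (by simpa using hPx) x0
  let J := (weakPsiC X).out
  let ι := (cellularity X).out
  have hx : ∀ x : X, ∃ s : J → ι → T, ({x} : Set X) = ⋂ j, closure (⋃ i, E (s j i)) := by
    intro x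
    have hV : ∃ V : J → Set X, (∀ j, IsOpen (V j)) ∧ ({x} : Set X) = ⋂ j, closure (V j) := by
      obtain ⟨_, 𝒱, h1, h2, h3⟩ := weakPsiCAt_spec X x
      rcases 𝒱.eq_empty_or_nonempty with rfl | hne
      · refine ⟨fun _ => univ, fun _ => isOpen_univ, ?_⟩
        rw [h2]; simp
      · have := hne.to_subtype
        have h4 : #𝒱 ≤ #J := by
          simpa [J] using h3.trans (hWx x)
        obtain ⟨f, hf⟩ := exists_surj h4
        refine ⟨fun j => f j, fun j => h1 _ (f j).2, ?_⟩
        rw [h2, biInter_eq_iInter]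
        exact (hf.iInter_comp (fun v : 𝒱 => closure (v : Set X))).symm
    obtain ⟨V, hVo, hVx⟩ := hV
    have hne : ∀ j, (V j).Nonempty := by
      intro j
      refine closure_nonempty_iff.1 ⟨x, ?_⟩
      have : x ∈ ⋂ j, closure (V j) := hVx ▸ mem_singleton x
      exact mem_iInter.1 this j
    choose s hs using fun j => hE (V j) (hVo j) (hne j)
    exact ⟨s, by rw [hVx]; exact iInter_congr hs⟩
  choose s hs using hx
  have hinj : Function.Injective s := by
    intro x y hxy
    have := hs x
    rw [hxy, ← hs y] at this
    exact singleton_injective this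
  calc #X ≤ #(J → ι → T) := mk_le_of_injective hinj
    _ = (#T ^ cellularity X) ^ weakPsiC X := by simp [J, ι]
    _ ≤ ((piChar X ^ cellularity X) ^ cellularity X) ^ weakPsiC X := by
        refine power_le_power_right (power_le_power_right ?_)
        simpa using hT
    _ = piChar X ^ (cellularity X * weakPsiC X) := by
        rw [← power_mul, ← power_mul, ← mul_assoc, mul_eq_self hc]
end

section
/- Let X be a Hausdorff topological space. Then |X| ≤ πχ(X)^{c(X)·dψc(X)·wψc(X)} (cardinal exponentiation, with product of cardinals in the exponent). -/
open Set TopologicalSpace Cardinal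

universe u

variable (X : Type u) [TopologicalSpace X]

theorem aux_range {α I : Type u} (S : Set α) (hS : S.Nonempty) (h : #S ≤ #I) :
    ∃ f : I → α, range f = S := by
  obtain ⟨e⟩ := h
  have : Nonempty S := hS.to_subtype
  refine ⟨fun i => (Function.invFun e i : S), ?_⟩
  have hs := Function.invFun_surjective e.injective
  ext x
  constructor
  · rintro ⟨i, rfl⟩
    exact Subtype.coe_prop _
  · intro hx
    obtain ⟨i, hi⟩ := hs ⟨x, hx⟩
    exact ⟨i, by simp [hi]⟩

theorem aux_cell {X I : Type u} [TopologicalSpace X]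
    (hc : ∀ 𝒰 : Set (Set X), (∀ U ∈ 𝒰, IsOpen U ∧ U.Nonempty) →
      (𝒰.Pairwise fun U V => U ∩ V = ∅) → #𝒰 ≤ #I)
    {K : Type u} (G : K → Set X) (hG : ∀ k, IsOpen (G k)) (k0 : K) :
    ∃ g : I → K, ∀ k, G k ⊆ closure (⋃ i, G (g i)) := by
  obtain ⟨M, hM⟩ := zorn_subset
    {𝒰 : Set (Set X) | (∀ U ∈ 𝒰, IsOpen U ∧ U.Nonempty ∧ ∃ k, U ⊆ G k) ∧
      (𝒰.Pairwise fun U V => U ∩ V = ∅)} (by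
    intro c hc hchain
    refine ⟨⋃₀ c, ⟨?_, ?_⟩, fun s hs => subset_sUnion_of_mem hs⟩
    · rintro U ⟨s, hs, hU⟩
      exact (hc hs).1 U hU
    · exact (pairwise_sUnion hchain.directedOn).2 fun s hs => (hc hs).2)
  have hM1 := hM.prop
  have hcard := hc M (fun U hU => ⟨(hM1.1 U hU).1, (hM1.1 U hU).2.1⟩) hM1.2
  have : Nonempty K := ⟨k0⟩
  choose! φ hφ using fun U hU => (hM1.1 U hU).2.2
  have key : ∀ (T : Set X), (∀ U ∈ M, U ⊆ T) → ∀ k, G k ⊆ closure T := by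
    intro T hT k x hx
    by_contra hxT
    let N := G k ∩ (closure T)ᶜ
    have hN : IsOpen N := (hG k).inter isClosed_closure.isOpen_compl
    have hNn : N.Nonempty := ⟨x, hx, hxT⟩
    have hdis : ∀ U ∈ M, N ∩ U = ∅ := by
      intro U hU
      ext y
      simp only [mem_inter_iff, mem_empty_iff_false, iff_false, not_and]
      intro hy hyU
      exact hy.2 (subset_closure (hT U hU hyU))
    have hmem : insert N M ∈ {𝒰 : Set (Set X) |
        (∀ U ∈ 𝒰, IsOpen U ∧ U.Nonempty ∧ ∃ k, U ⊆ G k) ∧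
        (𝒰.Pairwise fun U V => U ∩ V = ∅)} := by
      refine ⟨?_, ?_⟩
      · rintro U (rfl | hU)
        · exact ⟨hN, hNn, k, inter_subset_left⟩
        · exact hM1.1 U hU
      · refine hM1.2.insert fun U hU _ => ⟨hdis U hU, ?_⟩
        rw [inter_comm]; exact hdis U hU
    have hNM : N ∈ M := hM.le_of_ge hmem (subset_insert _ _) (mem_insert _ _)
    exact hNn.ne_empty (by simpa using hdis N hNM)
  rcases M.eq_empty_or_nonempty with h | h
  · refine ⟨fun _ => k0, fun k => ?_⟩
    apply key
    simp [h]
  · obtain ⟨f, hf⟩ := aux_range M h hcard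
    refine ⟨fun i => φ (f i), fun k => key _ ?_ k⟩
    intro U hU
    have hU' := hU
    rw [← hf] at hU'
    obtain ⟨i, rfl⟩ := hU'
    exact (hφ _ hU).trans (subset_iUnion (fun i => G (φ (f i))) i)

theorem aux_core {X I L : Type u} [TopologicalSpace X] [Infinite I] [Infinite L]
    (hc : ∀ 𝒰 : Set (Set X), (∀ U ∈ 𝒰, IsOpen U ∧ U.Nonempty) →
      (𝒰.Pairwise fun U V => U ∩ V = ∅) → #𝒰 ≤ #I)
    (D : Set X) (hD : Dense D) (hDn : D.Nonempty)
    (B : X → L → Set X) (hBo : ∀ x l, IsOpen (B x l)) (hB0 : ∀ x, ∃ l, B x l = ∅)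
    (hB : ∀ x U, IsOpen U → x ∈ U → ∃ l, (B x l).Nonempty ∧ B x l ⊆ U)
    (V : X → I → Set X) (hVo : ∀ d ∈ D, ∀ i, IsOpen (V d i) ∧ d ∈ V d i)
    (hV : ∀ d ∈ D, ⋂ i, closure (V d i) = {d})
    (W : X → I → Set X) (hWo : ∀ x i, IsOpen (W x i))
    (hW : ∀ x, ⋂ i, closure (W x i) = {x}) : #X ≤ #L ^ #I := by
  have hI : ℵ₀ ≤ #I := aleph0_le_mk I
  have hL : ℵ₀ ≤ #L := aleph0_le_mk L
  have hμ : ℵ₀ ≤ #L ^ #I := hL.trans (self_le_power _ (one_le_aleph0.trans hI))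
  have hμI : (#L ^ #I) ^ #I = #L ^ #I := by rw [← power_mul, mul_eq_self hI]
  have hLμ : #L ≤ #L ^ #I := self_le_power _ (one_le_aleph0.trans hI)
  -- local approximation
  have approx : ∀ A : Set X, A.Nonempty → ∀ U, IsOpen U →
      ∃ g : I → A × L, (∀ i, B (g i).1 (g i).2 ⊆ U) ∧
        A ∩ U ⊆ closure (⋃ i, B (g i).1 (g i).2) := by
    rintro A ⟨a0, ha0⟩ U hU
    obtain ⟨l0, hl0⟩ := hB0 a0
    let K := {p : A × L // B p.1 p.2 ⊆ U}
    obtain ⟨g, hg⟩ := aux_cell hc (K := K) (fun p => B p.1.1 p.1.2) (fun p => hBo _ _)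
      ⟨(⟨a0, ha0⟩, l0), by simp [hl0]⟩
    refine ⟨fun i => (g i).1, fun i => (g i).2, ?_⟩
    rintro x ⟨hxA, hxU⟩
    rw [mem_closure_iff]
    intro O hO hxO
    obtain ⟨l, ⟨y, hy⟩, hl2⟩ := hB x (U ∩ O) (hU.inter hO) ⟨hxU, hxO⟩
    have := hg ⟨(⟨x, hxA⟩, l), hl2.trans inter_subset_left⟩ hy
    exact mem_closure_iff.1 this O hO (hl2 hy).2
  -- size of D
  have hDcard : #D ≤ #L ^ #I := by
    have hF : ∀ g : I × I → X × L, ∃ p ∈ D,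
        (∃ q ∈ D, ∀ i, q ∉ closure (⋃ j, B (g (i, j)).1 (g (i, j)).2)) →
        ∀ i, p ∉ closure (⋃ j, B (g (i, j)).1 (g (i, j)).2) := by
      intro g
      by_cases h : ∃ q ∈ D, ∀ i, q ∉ closure (⋃ j, B (g (i, j)).1 (g (i, j)).2)
      · obtain ⟨q, hq, hq'⟩ := h
        exact ⟨q, hq, fun _ => hq'⟩
      · obtain ⟨q, hq⟩ := hDn
        exact ⟨q, hq, fun h' => absurd h' h⟩
    choose F hFD hF using hF
    obtain ⟨p0, hp0⟩ := hDn
    let β : Option (I × I → L) → Type u := fun o => Option.elim o PEmpty.{u+1} (fun _ => I × I)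
    let step : (Σ a : Option (I × I → L), β a → X) → X := fun s =>
      match s with
      | ⟨none, _⟩ => p0
      | ⟨some a, f⟩ => F (fun i => (f i, a i))
    let ev : WType β → X := WType.elim X step
    have hWc : #(WType β) ≤ #L ^ #I := by
      apply WType.cardinalMk_le_of_le
      have h1 : ∀ a : Option (I × I → L), (#L ^ #I) ^ #(β a) ≤ #L ^ #I := by
        rintro (_ | a)
        · have : #(β none) = 0 := mk_eq_zero PEmpty
          rw [this, power_zero]
          exact one_le_aleph0.trans hμ
        · have : #(β (some a)) = #I := by
            change #(I × I) = _
            rw [mk_prod, lift_id, mul_eq_self hI]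
          rw [this, hμI]
      refine (sum_le_sum _ _ h1).trans ?_
      rw [sum_const, lift_id, lift_id, mk_option]
      have : #(I × I → L) = #L ^ #I := by
        rw [← power_def, mk_prod, lift_id, mul_eq_self hI]
      rw [this]
      refine (mul_le_mul' (add_le_of_le hμ le_rfl (one_le_aleph0.trans hμ)) le_rfl).trans ?_
      rw [mul_eq_self hμ]
    let A := range ev
    have hp0A : p0 ∈ A := ⟨WType.mk none PEmpty.elim, rfl⟩
    have hAD : D ⊆ A := by
      intro p hp
      by_contra hpA
      choose g hg1 hg2 using fun i => approx A ⟨p0, hp0A⟩ (closure (V p i))ᶜ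
        isClosed_closure.isOpen_compl
      have hpn : ∀ i, p ∉ closure (⋃ j, B (g i j).1 (g i j).2) := by
        intro i hi
        obtain ⟨y, hy1, hy2⟩ := mem_closure_iff.1 hi _ (hVo p hp i).1 (hVo p hp i).2
        obtain ⟨j, hj⟩ := mem_iUnion.1 hy2
        exact hg1 i j hj (subset_closure hy1)
      choose w hw using fun i j => (g i j).1.2
      let G : I × I → X × L := fun q => ((g q.1 q.2).1, (g q.1 q.2).2)
      have hFG := hF G ⟨p, hp, hpn⟩
      have hFA : F G ∈ A := by
        refine ⟨WType.mk (some fun q => (g q.1 q.2).2) fun q : I × I => w q.1 q.2, ?_⟩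
        change F _ = F G
        congr 1
        funext q
        exact Prod.ext (hw q.1 q.2) rfl
      have hne : F G ≠ p := fun h => hpA (h ▸ hFA)
      have : F G ∉ ⋂ i, closure (V p i) := by
        rw [hV p hp]; exact hne
      simp only [mem_iInter, not_forall] at this
      obtain ⟨i, hi⟩ := this
      exact hFG i (hg2 i ⟨hFA, hi⟩)
    exact (mk_le_mk_of_subset hAD).trans (mk_range_le.trans hWc)
  -- size of X
  have hreg : ∀ U : Set X, IsOpen U →
      ∃ g : I → D × L, closure (⋃ i, B (g i).1 (g i).2) = closure U := by
    intro U hU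
    obtain ⟨g, hg1, hg2⟩ := approx D hDn U hU
    refine ⟨g, (closure_mono (iUnion_subset hg1)).antisymm ?_⟩
    refine closure_minimal ?_ isClosed_closure
    refine Subset.trans ?_ (closure_minimal hg2 isClosed_closure)
    rw [inter_comm]
    exact hD.open_subset_closure_inter hU
  choose g hg using fun x i => hreg (W x i) (hWo x i)
  have hinj : Function.Injective g := by
    intro x y hxy
    have : ({x} : Set X) = {y} := by
      rw [← hW x, ← hW y]
      simp only [← hg, hxy]
    exact singleton_injective this
  refine (mk_le_of_injective hinj).trans ?_
  have h2 : #(D × L) ≤ #L ^ #I := by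
    rw [mk_prod, lift_id, lift_id]
    exact (mul_le_mul' hDcard hLμ).trans (mul_eq_self hμ).le
  rw [← power_def, ← power_def]
  calc (#(D × L) ^ #I) ^ #I ≤ ((#L ^ #I) ^ #I) ^ #I :=
        power_le_power_right (power_le_power_right h2)
    _ = _ := by rw [hμI, hμI]

theorem aux_nbhds {X : Type u} [TopologicalSpace X] [T2Space X] (x : X) :
    ({x} : Set X) = ⋂ V ∈ {V : Set X | IsOpen V ∧ x ∈ V}, closure V := by
  ext y
  simp only [mem_singleton_iff, mem_iInter, mem_ofPred_eq]
  constructor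
  · rintro rfl V ⟨_, h⟩
    exact subset_closure h
  · intro h
    by_contra hne
    obtain ⟨u, v, hu, hv, hyu, hxv, huv⟩ := t2_separation hne
    obtain ⟨z, hz1, hz2⟩ := mem_closure_iff.1 (h v ⟨hv, hxv⟩) u hu hyu
    exact disjoint_left.1 huv hz1 hz2

theorem stmt_6 (X : Type u) [TopologicalSpace X] [T2Space X] :
    #X ≤ piChar X ^ (cellularity X * densePsiC X * weakPsiC X) := by
  rcases isEmpty_or_nonempty X with hX | hX
  · simp
  obtain ⟨x0⟩ := id hX
  have hc : cellularity X ∈ {κ : Cardinal.{u} | ℵ₀ ≤ κ ∧ ∀ 𝒰 : Set (Set X),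
    (∀ U ∈ 𝒰, IsOpen U ∧ U.Nonempty) → (𝒰.Pairwise fun U V => U ∩ V = ∅) → #𝒰 ≤ κ} := csInf_mem (by exact ⟨max ℵ₀ #(Set X), le_max_left _ _,
    fun 𝒰 _ _ => (mk_set_le 𝒰).trans (le_max_right _ _)⟩)
  have hp : ∀ x, piCharAt X x ∈ {κ : Cardinal.{u} | ℵ₀ ≤ κ ∧ ∃ ℬ : Set (Set X),
    (∀ B ∈ ℬ, IsOpen B ∧ B.Nonempty) ∧
    (∀ U : Set X, IsOpen U → x ∈ U → ∃ B ∈ ℬ, B ⊆ U) ∧ #ℬ ≤ κ} := fun x => csInf_mem (by exact ⟨max ℵ₀ #(Set X), le_max_left _ _,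
    {U | IsOpen U ∧ U.Nonempty}, fun _ h => h, fun U hU hx => ⟨U, ⟨hU, x, hx⟩, Subset.rfl⟩,
    (mk_set_le _).trans (le_max_right _ _)⟩)
  have hps : ∀ x, closedPseudoCharAt X x ∈ {κ : Cardinal.{u} | ℵ₀ ≤ κ ∧ ∃ 𝒱 : Set (Set X),
    (∀ V ∈ 𝒱, IsOpen V ∧ x ∈ V) ∧ #𝒱 ≤ κ ∧
    ({x} : Set X) = ⋂₀ 𝒱 ∧ ({x} : Set X) = ⋂ V ∈ 𝒱, closure V} := fun x => csInf_mem (by exact ⟨max ℵ₀ #(Set X),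
    le_max_left _ _, {U | IsOpen U ∧ x ∈ U}, fun _ h => h,
    (mk_set_le _).trans (le_max_right _ _), by
      apply Subset.antisymm
      · rintro y rfl V ⟨_, h⟩
        exact h
      · rw [aux_nbhds x]
        intro y hy
        simp only [mem_iInter]
        exact fun V hV => subset_closure (hy V hV), aux_nbhds x⟩)
  have hw : ∀ x, weakPsiCAt X x ∈ {κ : Cardinal.{u} | ℵ₀ ≤ κ ∧ ∃ 𝒱 : Set (Set X),
    (∀ V ∈ 𝒱, IsOpen V) ∧ (({x} : Set X) = ⋂ V ∈ 𝒱, closure V) ∧ #𝒱 ≤ κ} := fun x => csInf_mem (by exact ⟨max ℵ₀ #(Set X), le_max_left _ _,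
    {U | IsOpen U ∧ x ∈ U}, fun _ h => h.1, aux_nbhds x,
    (mk_set_le _).trans (le_max_right _ _)⟩)
  have hd : densePsiC X ∈ {κ : Cardinal.{u} | ℵ₀ ≤ κ ∧ ∃ D : Set X, Dense D ∧
    ∀ d ∈ D, closedPseudoCharAt X d ≤ κ} := csInf_mem (by exact ⟨max ℵ₀ (⨆ x, closedPseudoCharAt X x),
    le_max_left _ _, Set.univ, dense_univ, fun d _ =>
      (le_ciSup (bddAbove_of_small) d).trans (le_max_right _ _)⟩)
  have hpl : ∀ x, piCharAt X x ≤ piChar X := fun x => le_ciSup bddAbove_of_small x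
  have hwl : ∀ x, weakPsiCAt X x ≤ weakPsiC X := fun x => le_ciSup bddAbove_of_small x
  obtain ⟨hc1, hc2⟩ := hc
  obtain ⟨hd1, D, hD, hd2⟩ := hd
  change ℵ₀ ≤ cellularity X at hc1
  change ℵ₀ ≤ densePsiC X at hd1
  have hw1 : ℵ₀ ≤ weakPsiC X := (hw x0).1.trans (hwl x0)
  have hp1 : ℵ₀ ≤ piChar X := (hp x0).1.trans (hpl x0)
  set κ := cellularity X * densePsiC X * weakPsiC X with hκ
  have n1 := (aleph0_pos.trans_le hc1).ne'
  have n2 := (aleph0_pos.trans_le hd1).ne'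
  have n3 := (aleph0_pos.trans_le hw1).ne'
  have hcκ : cellularity X ≤ κ := (le_mul_right n2).trans (le_mul_right n3)
  have hdκ : densePsiC X ≤ κ := (le_mul_left n1).trans (le_mul_right n3)
  have hwκ : weakPsiC X ≤ κ := le_mul_left (mul_ne_zero n1 n2)
  have hκ0 : ℵ₀ ≤ κ := hc1.trans hcκ
  have hIi : Infinite κ.out := by rw [infinite_iff, mk_out]; exact hκ0
  have hLi : Infinite (piChar X).out := by rw [infinite_iff, mk_out]; exact hp1
  have hins : ∀ (μ : Cardinal.{u}) (S : Set (Set X)) (a : Set X), ℵ₀ ≤ μ → #S ≤ μ →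
      #(insert a S : Set (Set X)) ≤ #μ.out := by
    intro μ S a h0 h
    rw [mk_out]
    exact mk_insert_le.trans (add_le_of_le h0 h (one_le_aleph0.trans h0))
  have eB : ∀ x, ∃ B : (piChar X).out → Set X, (∀ l, IsOpen (B l)) ∧ (∃ l, B l = ∅) ∧
      ∀ U, IsOpen U → x ∈ U → ∃ l, (B l).Nonempty ∧ B l ⊆ U := by
    intro x
    obtain ⟨-, S, h1, h2, h3⟩ := hp x
    obtain ⟨f, hf⟩ := aux_range (insert ∅ S) (insert_nonempty _ _)
      (hins _ S ∅ hp1 (h3.trans (hpl x)))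
    refine ⟨f, fun l => ?_, ?_, fun U hU hx => ?_⟩
    · have : f l ∈ insert ∅ S := hf ▸ mem_range_self l
      rcases this with h | h
      · rw [h]; exact isOpen_empty
      · exact (h1 _ h).1
    · have : ∅ ∈ range f := hf ▸ mem_insert _ _
      exact this
    · obtain ⟨b, hb, hbU⟩ := h2 U hU hx
      have : b ∈ range f := hf ▸ mem_insert_of_mem _ hb
      obtain ⟨l, rfl⟩ := this
      exact ⟨l, (h1 _ hb).2, hbU⟩
  have eG : ∀ (x : X) (S : Set (Set X)), #S ≤ κ → ({x} : Set X) = ⋂ V ∈ S, closure V →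
      ∃ f : κ.out → Set X, (∀ i, f i = Set.univ ∨ f i ∈ S) ∧ ⋂ i, closure (f i) = {x} := by
    intro x S hS h
    obtain ⟨f, hf⟩ := aux_range (insert Set.univ S) (insert_nonempty _ _) (hins _ S Set.univ hκ0 hS)
    refine ⟨f, fun i => ?_, ?_⟩
    · have : f i ∈ insert Set.univ S := hf ▸ mem_range_self i
      exact this
    · rw [← biInter_range (f := f) (g := fun V => closure V), hf, biInter_insert, h]
      simp
  have eV : ∀ x, ∃ V : κ.out → Set X, x ∈ D → (∀ i, IsOpen (V i) ∧ x ∈ V i) ∧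
      ⋂ i, closure (V i) = {x} := by
    intro x
    by_cases hx : x ∈ D
    · obtain ⟨-, S, h1, h2, h3, h4⟩ := hps x
      obtain ⟨f, hf1, hf2⟩ := eG x S (h2.trans ((hd2 x hx).trans hdκ)) h4
      refine ⟨f, fun _ => ⟨fun i => ?_, hf2⟩⟩
      rcases hf1 i with h | h
      · rw [h]; exact ⟨isOpen_univ, mem_univ _⟩
      · exact h1 _ h
    · exact ⟨fun _ => univ, fun h => absurd h hx⟩
  have eW : ∀ x, ∃ V : κ.out → Set X, (∀ i, IsOpen (V i)) ∧ ⋂ i, closure (V i) = {x} := by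
    intro x
    obtain ⟨-, S, h1, h2, h3⟩ := hw x
    obtain ⟨f, hf1, hf2⟩ := eG x S (h3.trans ((hwl x).trans hwκ)) h2
    refine ⟨f, fun i => ?_, hf2⟩
    rcases hf1 i with h | h
    · rw [h]; exact isOpen_univ
    · exact h1 _ h
  choose B hB1 hB2 hB3 using eB
  choose V hV using eV
  choose W hW1 hW2 using eW
  have := aux_core (X := X) (I := κ.out) (L := (piChar X).out)
    (fun 𝒰 h1 h2 => by rw [mk_out]; exact (hc2 𝒰 h1 h2).trans hcκ) D hD hD.nonempty
    B hB1 hB2 hB3 V (fun d hd => (hV d hd).1) (fun d hd => (hV d hd).2) W hW1 hW2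
  rwa [mk_out, mk_out] at this
end

section
/- Let X be a Hausdorff topological space. Then wψc(X) ≤ πχ(X)^{ot(X)} (cardinal exponentiation). -/
open Set TopologicalSpace Cardinal

universe u

variable (X : Type u) [TopologicalSpace X]

theorem stmt_7 (X : Type u) [TopologicalSpace X] [T2Space X] :
    weakPsiC X ≤ piChar X ^ oTightness X := by
  have hot := csInf_mem (s := {κ : Cardinal.{u} | ℵ₀ ≤ κ ∧ ∀ (x : X) (𝒰 : Set (Set X)),
    (∀ U ∈ 𝒰, IsOpen U) → x ∈ closure (⋃₀ 𝒰) →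
    ∃ 𝒱 ⊆ 𝒰, #𝒱 ≤ κ ∧ x ∈ closure (⋃₀ 𝒱)})
    ⟨max ℵ₀ #(Set X), le_max_left _ _, fun x 𝒰 _ h =>
      ⟨𝒰, subset_rfl, (mk_set_le 𝒰).trans (le_max_right _ _), h⟩⟩
  change ℵ₀ ≤ oTightness X ∧ _ at hot
  obtain ⟨hot0, hot⟩ := hot
  change ∀ (x : X) (𝒰 : Set (Set X)),
    (∀ U ∈ 𝒰, IsOpen U) → x ∈ closure (⋃₀ 𝒰) →
    ∃ 𝒱 ⊆ 𝒰, #𝒱 ≤ oTightness X ∧ x ∈ closure (⋃₀ 𝒱) at hot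
  refine ciSup_le' fun x => ?_
  have hpi := csInf_mem (s := {κ : Cardinal.{u} | ℵ₀ ≤ κ ∧ ∃ ℬ : Set (Set X),
    (∀ B ∈ ℬ, IsOpen B ∧ B.Nonempty) ∧
    (∀ U : Set X, IsOpen U → x ∈ U → ∃ B ∈ ℬ, B ⊆ U) ∧ #ℬ ≤ κ})
    ⟨max ℵ₀ #(Set X), le_max_left _ _, {B | IsOpen B ∧ B.Nonempty}, fun B h => h,
      fun U hU hx => ⟨U, ⟨hU, x, hx⟩, subset_rfl⟩, (mk_set_le _).trans (le_max_right _ _)⟩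
  change ℵ₀ ≤ piCharAt X x ∧ _ at hpi
  obtain ⟨hpi0, ℬ, hB, hBx, hBc⟩ := hpi
  change #ℬ ≤ piCharAt X x at hBc
  have hle : piCharAt X x ≤ piChar X := le_ciSup (f := fun x => piCharAt X x)
    (bddAbove_range _) x
  have hp0 : ℵ₀ ≤ piChar X := hpi0.trans hle
  have h1 : (1 : Cardinal) ≤ oTightness X := one_le_aleph0.trans hot0
  have key : ∀ U : Set X, IsOpen U → x ∈ U → ∃ 𝒞 ⊆ ℬ, #𝒞 ≤ oTightness X ∧
      x ∈ closure (⋃₀ 𝒞) ∧ ⋃₀ 𝒞 ⊆ U := by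
    intro U hU hxU
    obtain ⟨𝒞, h𝒞, hc, hx⟩ := hot x {B | B ∈ ℬ ∧ B ⊆ U} (fun B h => (hB B h.1).1) (by
      rw [mem_closure_iff]
      intro N hN hxN
      obtain ⟨B, hBB, hBN⟩ := hBx (N ∩ U) (hN.inter hU) ⟨hxN, hxU⟩
      obtain ⟨z, hz⟩ := (hB B hBB).2
      exact ⟨z, (hBN hz).1, B, ⟨hBB, fun w hw => (hBN hw).2⟩, hz⟩)
    exact ⟨𝒞, fun B h => (h𝒞 h).1, hc, hx, sUnion_subset fun B h => (h𝒞 h).2⟩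
  refine csInf_le' ⟨hp0.trans (self_le_power _ h1),
    sUnion '' {𝒞 : Set (Set X) | (𝒞 ⊆ ℬ ∧ #𝒞 ≤ oTightness X) ∧ x ∈ closure (⋃₀ 𝒞)}, ?_, ?_, ?_⟩
  · rintro _ ⟨𝒞, h, rfl⟩
    exact isOpen_sUnion fun B hb => (hB B (h.1.1 hb)).1
  · apply Set.Subset.antisymm
    · rintro _ rfl
      simp only [mem_iInter]
      rintro _ ⟨𝒞, h, rfl⟩
      exact h.2
    · intro y hy
      by_contra hne
      obtain ⟨U, W, hU, hW, hxU, hyW, hd⟩ := t2_separation (Ne.symm hne : x ≠ y)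
      obtain ⟨𝒞, h1, h2, h3, h4⟩ := key U hU hxU
      have := mem_iInter₂.1 hy _ ⟨𝒞, ⟨⟨h1, h2⟩, h3⟩, rfl⟩
      obtain ⟨z, hz, hz'⟩ := mem_closure_iff.1 this W hW hyW
      exact Set.disjoint_left.1 hd (h4 hz') hz
  · refine mk_image_le.trans ((mk_le_mk_of_subset (t := {𝒞 : Set (Set X) | 𝒞 ⊆ ℬ ∧ #𝒞 ≤ oTightness X}) fun _ h => h.1).trans ?_)
    refine (mk_bounded_subset_le ℬ (oTightness X)).trans ?_
    exact power_le_power_right (max_le (hBc.trans hle) hp0)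
end

section
/- Let X be a Hausdorff topological space. Then wψc(X) ≤ πw(X)^{dot(X)} (cardinal exponentiation). -/
open Set TopologicalSpace Cardinal

universe u

variable (X : Type u) [TopologicalSpace X]

theorem stmt_8 (X : Type u) [TopologicalSpace X] [T2Space X] :
    weakPsiC X ≤ piWeight X ^ denseOTightness X := by
  classical
  have hw : ℵ₀ ≤ piWeight X ∧ ∃ ℬ : Set (Set X),
      (∀ B ∈ ℬ, IsOpen B ∧ B.Nonempty) ∧
      (∀ U : Set X, IsOpen U → U.Nonempty → ∃ B ∈ ℬ, B ⊆ U) ∧ #ℬ ≤ piWeight X := by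
    refine csInf_mem (s := {κ : Cardinal.{u} | ℵ₀ ≤ κ ∧ ∃ ℬ : Set (Set X),
      (∀ B ∈ ℬ, IsOpen B ∧ B.Nonempty) ∧
      (∀ U : Set X, IsOpen U → U.Nonempty → ∃ B ∈ ℬ, B ⊆ U) ∧ #ℬ ≤ κ}) ?_
    exact ⟨max ℵ₀ #{B : Set X | IsOpen B ∧ B.Nonempty}, le_max_left _ _,
      {B : Set X | IsOpen B ∧ B.Nonempty}, fun B hB => hB,
      fun U hU hn => ⟨U, ⟨hU, hn⟩, subset_rfl⟩, le_max_right _ _⟩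
  have ht : ℵ₀ ≤ denseOTightness X ∧ ∀ (x : X) (𝒰 : Set (Set X)),
      (∀ U ∈ 𝒰, IsOpen U) → Dense (⋃₀ 𝒰) →
      ∃ 𝒱 ⊆ 𝒰, #𝒱 ≤ denseOTightness X ∧ x ∈ closure (⋃₀ 𝒱) := by
    refine csInf_mem (s := {κ : Cardinal.{u} | ℵ₀ ≤ κ ∧ ∀ (x : X) (𝒰 : Set (Set X)),
      (∀ U ∈ 𝒰, IsOpen U) → Dense (⋃₀ 𝒰) →
      ∃ 𝒱 ⊆ 𝒰, #𝒱 ≤ κ ∧ x ∈ closure (⋃₀ 𝒱)}) ?_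
    exact ⟨max ℵ₀ #(Set X), le_max_left _ _, fun x 𝒰 _ hd =>
      ⟨𝒰, subset_rfl, (mk_set_le 𝒰).trans (le_max_right _ _), hd x⟩⟩
  obtain ⟨hw0, ℬ, hℬ, hπ, hcard⟩ := hw
  obtain ⟨ht0, ht⟩ := ht
  generalize piWeight X = w at *
  generalize denseOTightness X = κ at *
  have hwκ : w ≤ w ^ κ := self_le_power w (one_le_aleph0.trans ht0)
  refine ciSup_le' fun x => csInf_le' ⟨hw0.trans hwκ, ?_⟩
  refine ⟨{V | ∃ 𝒞 : Set (Set X), (𝒞 ⊆ ℬ ∧ #𝒞 ≤ κ) ∧ x ∈ closure (⋃₀ 𝒞) ∧ V = ⋃₀ 𝒞},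
    ?_, ?_, ?_⟩
  · rintro V ⟨𝒞, ⟨h1, -⟩, -, rfl⟩
    exact isOpen_sUnion fun t htt => (hℬ t (h1 htt)).1
  · refine Subset.antisymm ?_ ?_
    · rintro _ rfl
      simp only [mem_iInter]
      rintro V ⟨𝒞, -, h, rfl⟩
      exact h
    · intro y hy
      by_contra hne
      have hne : x ≠ y := fun h => hne h.symm
      obtain ⟨U, V, hU, hV, hxU, hyV, hd⟩ := t2_separation hne
      obtain ⟨𝒱, hsub, hc, hx⟩ := ht x {B | B ∈ ℬ ∧ (B ⊆ U ∨ Disjoint B U)}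
        (fun B hB => (hℬ B hB.1).1) (by
          rw [dense_iff_inter_open]
          intro W hW hWn
          by_cases hWU : (W ∩ U).Nonempty
          · obtain ⟨B, hB, hBs⟩ := hπ _ (hW.inter hU) hWU
            obtain ⟨z, hz⟩ := (hℬ B hB).2
            exact ⟨z, (hBs hz).1, B, ⟨hB, Or.inl fun a ha => (hBs ha).2⟩, hz⟩
          · obtain ⟨B, hB, hBs⟩ := hπ _ hW hWn
            obtain ⟨z, hz⟩ := (hℬ B hB).2
            refine ⟨z, hBs hz, B, ⟨hB, Or.inr ?_⟩, hz⟩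
            rw [Set.disjoint_left]
            exact fun a ha ha' => hWU ⟨a, hBs ha, ha'⟩)
      have hmem : x ∈ closure (⋃₀ {B | B ∈ 𝒱 ∧ B ⊆ U}) := by
        rw [mem_closure_iff] at hx ⊢
        intro O hO hxO
        obtain ⟨z, ⟨hzO, hzU⟩, B, hB, hzB⟩ := hx (O ∩ U) (hO.inter hU) ⟨hxO, hxU⟩
        refine ⟨z, hzO, B, ⟨hB, ?_⟩, hzB⟩
        rcases (hsub hB).2 with h | h
        · exact h
        · exact absurd hzU (Set.disjoint_left.1 h hzB)
      simp only [mem_iInter] at hy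
      have hy' := hy _ ⟨{B | B ∈ 𝒱 ∧ B ⊆ U}, ⟨fun B hB => (hsub hB.1).1,
        (mk_le_mk_of_subset fun B hB => hB.1).trans hc⟩, hmem, rfl⟩
      obtain ⟨z, hzV, B, hB, hzB⟩ := mem_closure_iff.1 hy' V hV hyV
      exact Set.disjoint_left.1 hd (hB.2 hzB) hzV
  · have h1 : #{t : Set (Set X) // t ⊆ ℬ ∧ #t ≤ κ} ≤ w ^ κ :=
      (mk_bounded_subset_le ℬ κ).trans (power_le_power_right (max_le hcard hw0))
    refine le_trans ?_ h1
    refine le_trans (mk_le_mk_of_subset ?_)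
      (mk_range_le (f := fun t : {t : Set (Set X) // t ⊆ ℬ ∧ #t ≤ κ} => ⋃₀ t.1))
    rintro V ⟨𝒞, h, -, rfl⟩
    exact ⟨⟨𝒞, h⟩, rfl⟩
end

section
/- Let X be a Hausdorff topological space. Then wψc(X) ≤ 2^{d(X)} (cardinal exponentiation). -/
open Set TopologicalSpace Cardinal

universe u

variable (X : Type u) [TopologicalSpace X]

theorem stmt_9 (X : Type u) [TopologicalSpace X] [T2Space X] :
    weakPsiC X ≤ 2 ^ density X := by
  have hne : {κ : Cardinal.{u} | ℵ₀ ≤ κ ∧ ∃ D : Set X, Dense D ∧ #D ≤ κ}.Nonempty :=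
    ⟨max ℵ₀ #X, le_max_left _ _, Set.univ, dense_univ, by
      rw [Cardinal.mk_univ]; exact le_max_right _ _⟩
  obtain ⟨hinf, D, hD, hcard⟩ := csInf_mem hne
  change ℵ₀ ≤ density X at hinf
  change #D ≤ density X at hcard
  refine ciSup_le' fun x => csInf_le' ?_
  have h2 : (2 : Cardinal.{u}) ^ #D ≤ 2 ^ density X :=
    Cardinal.power_le_power_left two_ne_zero hcard
  refine ⟨hinf.trans (Cardinal.cantor _).le,
    {V | x ∈ V ∧ V ∈ (fun A : Set X => interior (closure A)) '' 𝒫 D}, ?_, ?_, ?_⟩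
  · rintro V ⟨-, A, -, rfl⟩
    exact isOpen_interior
  · apply Set.Subset.antisymm
    · rintro y rfl
      simp only [Set.mem_iInter]
      exact fun V hV => subset_closure hV.1
    · intro y hy
      by_contra hne'
      obtain ⟨U, W, hU, hW, hxU, hyW, hdis⟩ := t2_separation (Ne.symm hne' : x ≠ y)
      simp only [Set.mem_iInter] at hy
      have hsub : U ⊆ interior (closure (U ∩ D)) :=
        interior_maximal (hD.open_subset_closure_inter hU) hU
      have h := hy _ ⟨hsub hxU, U ∩ D, Set.inter_subset_right, rfl⟩
      have h' : y ∈ closure U :=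
        closure_mono Set.inter_subset_left
          (closure_minimal interior_subset isClosed_closure h)
      exact (hdis.symm.closure_right hW).notMem_of_mem_left hyW h'
  · refine le_trans ?_ h2
    refine (Cardinal.mk_le_mk_of_subset (fun V hV => hV.2)).trans ?_
    refine Cardinal.mk_image_le.trans ?_
    rw [Cardinal.mk_powerset]
end

section
/- Let X be a Hausdorff topological space. Then wψc(X) ≤ 2^{qψ(X)} (cardinal exponentiation). -/
open Set TopologicalSpace Cardinal

universe u

variable (X : Type u) [TopologicalSpace X]

theorem stmt_10 (X : Type u) [TopologicalSpace X] [T2Space X] :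
    weakPsiC X ≤ 2 ^ qPsi X := by
  unfold weakPsiC
  apply ciSup_le'
  intro x
  have hne : {κ : Cardinal.{u} | ℵ₀ ≤ κ ∧ ∃ ℬ : Set (Set X),
    (∀ B ∈ ℬ, IsOpen B ∧ B.Nonempty) ∧ #ℬ ≤ κ ∧
    ∀ y : X, y ≠ x → ∃ 𝒞 ⊆ ℬ, x ∈ closure (⋃₀ 𝒞) ∧ y ∉ closure (⋃₀ 𝒞)}.Nonempty := by
    let ℬ : Set (Set X) := {B | IsOpen B ∧ B.Nonempty}
    refine ⟨max ℵ₀ #ℬ, le_max_left _ _, ℬ, fun B hB => hB, le_max_right _ _, ?_⟩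
    intro y hy
    obtain ⟨u, v, hu, hv, hyu, hxv, hd⟩ := t2_separation hy
    refine ⟨{v}, ?_, ?_, ?_⟩
    · rintro _ rfl
      exact ⟨hv, x, hxv⟩
    · rw [sUnion_singleton]
      exact subset_closure hxv
    · rw [sUnion_singleton]
      intro h
      obtain ⟨z, hz1, hz2⟩ := mem_closure_iff.1 h u hu hyu
      exact Set.disjoint_left.1 hd hz1 hz2
  obtain ⟨hinf, ℬ, hB, hcard, hsep⟩ := csInf_mem hne
  have hle : qPsiAt X x ≤ qPsi X := le_ciSup (Cardinal.bddAbove_range _) x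
  change ℵ₀ ≤ qPsiAt X x at hinf
  change #ℬ ≤ qPsiAt X x at hcard
  refine csInf_le' ⟨?_, {V | ∃ 𝒞 ⊆ ℬ, x ∈ closure (⋃₀ 𝒞) ∧ V = ⋃₀ 𝒞}, ?_, ?_, ?_⟩
  · exact (hinf.trans hle).trans (Cardinal.cantor _).le
  · rintro V ⟨𝒞, hC, -, rfl⟩
    exact isOpen_sUnion fun t ht => (hB t (hC ht)).1
  · apply Subset.antisymm
    · rintro _ rfl
      simp only [mem_iInter]
      rintro V ⟨𝒞, hC, hx, rfl⟩
      exact hx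
    · intro y hy
      by_contra hyx
      obtain ⟨𝒞, hC, hx, hyC⟩ := hsep y hyx
      simp only [mem_iInter] at hy
      exact hyC (hy _ ⟨𝒞, hC, hx, rfl⟩)
  · have h1 : {V | ∃ 𝒞 ⊆ ℬ, x ∈ closure (⋃₀ 𝒞) ∧ V = ⋃₀ 𝒞} ⊆ sUnion '' (𝒫 ℬ) := by
      rintro V ⟨𝒞, hC, -, rfl⟩
      exact ⟨𝒞, hC, rfl⟩
    calc _ ≤ #(sUnion '' (𝒫 ℬ)) := Cardinal.mk_le_mk_of_subset h1
      _ ≤ #(𝒫 ℬ) := Cardinal.mk_image_le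
      _ = 2 ^ #ℬ := Cardinal.mk_powerset ℬ
      _ ≤ _ := Cardinal.power_le_power_left two_ne_zero (hcard.trans hle)
end

section
/- Let X be a quasiregular Hausdorff topological space. Then |X| ≤ 2^{c(X)·πχ(X)^{ot(X)}} (cardinal exponentiation, where the exponent is the cardinal product of c(X) and πχ(X)^{ot(X)}). -/
open Set TopologicalSpace Cardinal

universe u

variable (X : Type u) [TopologicalSpace X]

theorem cell_mem {X : Type u} [TopologicalSpace X] : ℵ₀ ≤ cellularity X ∧ ∀ 𝒰 : Set (Set X),
    (∀ U ∈ 𝒰, IsOpen U ∧ U.Nonempty) → (𝒰.Pairwise fun U V => U ∩ V = ∅) →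
      #𝒰 ≤ cellularity X := by
  have := csInf_mem (s := {κ : Cardinal.{u} | ℵ₀ ≤ κ ∧ ∀ 𝒰 : Set (Set X),
    (∀ U ∈ 𝒰, IsOpen U ∧ U.Nonempty) → (𝒰.Pairwise fun U V => U ∩ V = ∅) → #𝒰 ≤ κ})
    ⟨max ℵ₀ #(Set X), le_max_left _ _, fun 𝒰 _ _ => (mk_set_le 𝒰).trans (le_max_right _ _)⟩
  exact this

theorem pi_mem {X : Type u} [TopologicalSpace X] (x : X) : ℵ₀ ≤ piCharAt X x ∧
    ∃ ℬ : Set (Set X), (∀ B ∈ ℬ, IsOpen B ∧ B.Nonempty) ∧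
    (∀ U : Set X, IsOpen U → x ∈ U → ∃ B ∈ ℬ, B ⊆ U) ∧ #ℬ ≤ piCharAt X x := by
  have := csInf_mem (s := {κ : Cardinal.{u} | ℵ₀ ≤ κ ∧ ∃ ℬ : Set (Set X),
    (∀ B ∈ ℬ, IsOpen B ∧ B.Nonempty) ∧
    (∀ U : Set X, IsOpen U → x ∈ U → ∃ B ∈ ℬ, B ⊆ U) ∧ #ℬ ≤ κ})
    ⟨max ℵ₀ #(Set X), le_max_left _ _, {B | IsOpen B ∧ B.Nonempty}, fun B hB => hB,
      fun U hU hx => ⟨U, ⟨hU, x, hx⟩, subset_rfl⟩, (mk_set_le _).trans (le_max_right _ _)⟩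
  exact this

theorem ot_mem {X : Type u} [TopologicalSpace X] : ℵ₀ ≤ oTightness X ∧
    ∀ (x : X) (𝒰 : Set (Set X)),
    (∀ U ∈ 𝒰, IsOpen U) → x ∈ closure (⋃₀ 𝒰) →
    ∃ 𝒱 ⊆ 𝒰, #𝒱 ≤ oTightness X ∧ x ∈ closure (⋃₀ 𝒱) := by
  have := csInf_mem (s := {κ : Cardinal.{u} | ℵ₀ ≤ κ ∧ ∀ (x : X) (𝒰 : Set (Set X)),
    (∀ U ∈ 𝒰, IsOpen U) → x ∈ closure (⋃₀ 𝒰) →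
    ∃ 𝒱 ⊆ 𝒰, #𝒱 ≤ κ ∧ x ∈ closure (⋃₀ 𝒱)})
    ⟨max ℵ₀ #(Set X), le_max_left _ _, fun x 𝒰 _ h => ⟨𝒰, subset_rfl,
      (mk_set_le _).trans (le_max_right _ _), h⟩⟩
  exact this

/-- enumerate a small family -/
theorem enum_of_le {A K J : Type u} (h : #A ≤ #K) (j : A → J) (d : J) :
    ∃ f : K → J, (∀ a, ∃ k, f k = j a) ∧ ∀ k, f k = d ∨ ∃ a, f k = j a := by
  obtain ⟨e⟩ := h
  refine ⟨Function.extend e j (fun _ => d), fun a => ⟨e a, e.injective.extend_apply _ _ _⟩, ?_⟩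
  intro k
  by_cases hk : ∃ a, e a = k
  · obtain ⟨a, rfl⟩ := hk
    exact Or.inr ⟨a, e.injective.extend_apply _ _ _⟩
  · exact Or.inl (Function.extend_apply' _ _ _ hk)

theorem cell_enum {X : Type u} [TopologicalSpace X] (K : Type u) (hK : cellularity X ≤ #K)
    {J : Type u} (d : J) (w : J → Set X) (hw : ∀ j, IsOpen (w j)) :
    ∃ f : K → J, ∀ j, w j ⊆ closure (⋃ k, w (f k)) := by
  obtain ⟨m, hm⟩ := zorn_subset {𝒰 : Set (Set X) | (∀ U ∈ 𝒰, IsOpen U ∧ U.Nonempty ∧ ∃ j, U ⊆ w j) ∧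
      𝒰.Pairwise fun U V => U ∩ V = ∅} (by
    intro c hc hch
    refine ⟨⋃₀ c, ⟨?_, ?_⟩, fun s hs => subset_sUnion_of_mem hs⟩
    · rintro U ⟨s, hs, hU⟩
      exact (hc hs).1 U hU
    · exact (pairwise_sUnion hch.directedOn).2 fun s hs => (hc hs).2)
  have hcard : #m ≤ #K :=
    (cell_mem.2 m (fun U hU => ⟨(hm.1.1 U hU).1, (hm.1.1 U hU).2.1⟩) hm.1.2).trans hK
  have hj : ∀ U : m, ∃ j, U.1 ⊆ w j := fun U => (hm.1.1 U.1 U.2).2.2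
  choose j hj using hj
  obtain ⟨f, hf, -⟩ := enum_of_le hcard j d
  have hsub : ∀ U ∈ m, U ⊆ ⋃ k, w (f k) := by
    intro U hU
    obtain ⟨k, hk⟩ := hf ⟨U, hU⟩
    refine (hj ⟨U, hU⟩).trans ?_
    rw [← hk]
    exact subset_iUnion (fun k => w (f k)) k
  refine ⟨f, fun i x hx => ?_⟩
  by_contra hxc
  set Y := ⋃ k, w (f k)
  have hO : w i \ closure Y ∈ m := by
    refine hm.2 (y := insert (w i \ closure Y) m) ⟨?_, ?_⟩ (subset_insert _ _) (mem_insert _ _)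
    · rintro U (rfl | hU)
      · exact ⟨(hw i).sdiff isClosed_closure, ⟨x, hx, hxc⟩, i, sdiff_subset⟩
      · exact hm.1.1 U hU
    · refine hm.1.2.insert fun U hU _ => ?_
      have : (w i \ closure Y) ∩ U = ∅ := by
        ext z
        simp only [mem_inter_iff, mem_sdiff, mem_empty_iff_false, iff_false]
        rintro ⟨⟨_, h⟩, hz⟩
        exact h (subset_closure (hsub U hU hz))
      exact ⟨this, by rw [inter_comm]; exact this⟩
  exact hxc (subset_closure (hsub _ hO ⟨hx, hxc⟩))

theorem base_enum {X : Type u} [TopologicalSpace X] (P : Type u) (hP : piChar X ≤ #P) (x : X) :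
    ∃ b : P → Set X, (∀ p, IsOpen (b p) ∧ (b p).Nonempty) ∧
      ∀ U : Set X, IsOpen U → x ∈ U → ∃ p, b p ⊆ U := by
  obtain ⟨-, ℬ, h1, h2, h3⟩ := pi_mem x
  have h4 : piCharAt X x ≤ piChar X := le_ciSup (Cardinal.bddAbove_range (piCharAt X)) x
  obtain ⟨f, hf, hf'⟩ := enum_of_le (h3.trans (h4.trans hP)) (fun B : ℬ => B.1) Set.univ
  refine ⟨f, fun p => ?_, fun U hU hx => ?_⟩
  · rcases hf' p with h | ⟨a, h⟩
    · rw [h]; exact ⟨isOpen_univ, x, trivial⟩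
    · rw [h]; exact h1 _ a.2
  · obtain ⟨B, hB, hBU⟩ := h2 U hU hx
    obtain ⟨p, hp⟩ := hf ⟨B, hB⟩
    exact ⟨p, by rw [hp]; exact hBU⟩

/-- arities for the closing-off argument -/
def Ar (K P : Type u) : Option (K → P) → Type u
  | none => PEmpty
  | some _ => K

theorem Ar_card (K P : Type u) (hK : ℵ₀ ≤ #K) (hP : #P ≤ 2 ^ #K) :
    #(WType (Ar K P)) ≤ 2 ^ #K := by
  have hinf : ℵ₀ ≤ (2 : Cardinal.{u}) ^ #K := hK.trans (cantor _).le
  have hpow : ((2 : Cardinal.{u}) ^ #K) ^ #K = 2 ^ #K := by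
    rw [← power_mul, mul_eq_self hK]
  have hone : (1 : Cardinal.{u}) ≤ 2 ^ #K := one_le_aleph0.trans hinf
  apply WType.cardinalMk_le_of_le
  calc Cardinal.sum (fun a : Option (K → P) => ((2 : Cardinal.{u}) ^ #K) ^ #(Ar K P a))
      ≤ Cardinal.sum (fun a : Option (K → P) => (2 : Cardinal.{u}) ^ #K) := by
        apply Cardinal.sum_le_sum
        rintro (_ | s)
        · simpa [Ar] using hone
        · exact hpow.le
    _ = #(Option (K → P)) * 2 ^ #K := by simp
    _ ≤ 2 ^ #K * 2 ^ #K := by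
        gcongr
        rw [mk_option]
        refine add_le_of_le hinf ?_ hone
        rw [← hpow, ← power_def]
        exact power_le_power_right hP
    _ = 2 ^ #K := mul_eq_self hinf

theorem dens {X : Type u} [TopologicalSpace X] [Nonempty X] (hqr : QuasiRegular X) (K P : Type u)
    (hK : ℵ₀ ≤ #K) (hP : #P ≤ 2 ^ #K) (hc : cellularity X ≤ #K)
    (b : X → P → Set X) (hb : ∀ x p, IsOpen (b x p) ∧ (b x p).Nonempty)
    (hb' : ∀ x, ∀ U : Set X, IsOpen U → x ∈ U → ∃ p, b x p ⊆ U) :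
    ∃ (A : Type u) (a : A → X), #A ≤ 2 ^ #K ∧ DenseRange a := by
  classical
  have x0 : X := Classical.arbitrary X
  have hF : ∀ g : K → X × P, ∃ x : X, closure (⋃ k, b (g k).1 (g k).2) ≠ Set.univ →
      x ∉ closure (⋃ k, b (g k).1 (g k).2) := by
    intro g
    by_cases h : closure (⋃ k, b (g k).1 (g k).2) = Set.univ
    · exact ⟨x0, fun h' => (h' h).elim⟩
    · obtain ⟨x, hx⟩ := (ne_univ_iff_exists_notMem _).1 h
      exact ⟨x, fun _ => hx⟩
  choose F hF using hF
  let st : (Σ s : Option (K → P), (Ar K P s → X)) → X := fun q =>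
    match q with
    | ⟨none, _⟩ => x0
    | ⟨some s, g⟩ => F (fun k => (g k, s k))
  let a : WType (Ar K P) → X := WType.elim X st
  have hcl : ∀ g : K → WType (Ar K P) × P, ∃ w, a w = F (fun k => (a (g k).1, (g k).2)) := by
    intro g
    exact ⟨WType.mk (some fun k => (g k).2) (fun k => (g k).1), rfl⟩
  refine ⟨WType (Ar K P), a, Ar_card K P hK hP, ?_⟩
  by_contra hd
  have hne : (closure (range a))ᶜ.Nonempty := by
    rw [nonempty_compl]
    exact fun h => hd (dense_iff_closure_eq.2 h)
  obtain ⟨V, hVo, hVn, hV⟩ := hqr _ isClosed_closure.isOpen_compl hne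
  let J := {q : WType (Ar K P) × P // b (a q.1) q.2 ∩ V = ∅}
  have key : ∀ w : WType (Ar K P), ∀ U : Set X, IsOpen U → a w ∈ U →
      ∃ p, b (a w) p ⊆ U ∧ b (a w) p ∩ V = ∅ := by
    intro w U hU hw
    have : a w ∉ closure V := fun h => hV h (subset_closure (mem_range_self w))
    obtain ⟨p, hp⟩ := hb' (a w) (U \ closure V) (hU.sdiff isClosed_closure) ⟨hw, this⟩
    refine ⟨p, hp.trans sdiff_subset, ?_⟩
    ext z
    simp only [mem_inter_iff, mem_empty_iff_false, iff_false]
    exact fun h => (hp h.1).2 (subset_closure h.2)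
  let w0 : WType (Ar K P) := WType.mk none PEmpty.elim
  obtain ⟨p0, -, hp0⟩ := key w0 Set.univ isOpen_univ trivial
  obtain ⟨f, hf⟩ := cell_enum K hc (J := J) ⟨(w0, p0), hp0⟩ (fun q => b (a q.1.1) q.1.2)
    (fun q => (hb _ _).1)
  obtain ⟨w, hw⟩ := hcl (fun k => (f k).1)
  have hY : closure (⋃ k, b (a (f k).1.1) (f k).1.2) ≠ Set.univ := by
    intro h
    obtain ⟨v, hv⟩ := hVn
    have : v ∈ closure (⋃ k, b (a (f k).1.1) (f k).1.2) := h ▸ mem_univ v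
    obtain ⟨z, hzV, hz⟩ := mem_closure_iff.1 this V hVo hv
    obtain ⟨k, hk⟩ := mem_iUnion.1 hz
    have h2 : z ∈ b (a (f k).1.1) (f k).1.2 ∩ V := ⟨hk, hzV⟩
    rw [(f k).2] at h2
    exact h2
  have hnot := hF (fun k => (a (f k).1.1, (f k).1.2)) hY
  rw [← hw] at hnot
  obtain ⟨p, hp, hpV⟩ := key w _ isClosed_closure.isOpen_compl hnot
  obtain ⟨z, hz⟩ := (hb (a w) p).2
  exact hp hz (hf ⟨(w, p), hpV⟩ hz)

theorem stmt_11 (X : Type u) [TopologicalSpace X] [T2Space X] (hqr : QuasiRegular X) :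
    #X ≤ 2 ^ (cellularity X * piChar X ^ oTightness X) := by
  classical
  rcases isEmpty_or_nonempty X with hX | hX
  · simp
  have x0 : X := Classical.arbitrary X
  have hc0 : ℵ₀ ≤ cellularity X := cell_mem.1
  have ho0 : ℵ₀ ≤ oTightness X := ot_mem.1
  have hp0 : ℵ₀ ≤ piChar X :=
    (pi_mem x0).1.trans (le_ciSup (Cardinal.bddAbove_range (piCharAt X)) x0)
  have hpo : piChar X ≤ piChar X ^ oTightness X :=
    self_le_power _ (one_le_aleph0.trans ho0)
  have hpo0 : piChar X ^ oTightness X ≠ 0 := (aleph0_pos.trans_le (hp0.trans hpo)).ne'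
  have hc1 : cellularity X ≤ cellularity X * piChar X ^ oTightness X := le_mul_right hpo0
  have hc2 : piChar X ^ oTightness X ≤ cellularity X * piChar X ^ oTightness X :=
    le_mul_left (aleph0_pos.trans_le hc0).ne'
  obtain ⟨K, hKe⟩ : ∃ K : Type u, #K = cellularity X * piChar X ^ oTightness X := ⟨_, mk_out _⟩
  obtain ⟨P, hPe⟩ : ∃ P : Type u, #P = piChar X := ⟨_, mk_out _⟩
  obtain ⟨T, hTe⟩ : ∃ T : Type u, #T = oTightness X := ⟨_, mk_out _⟩
  rw [← hKe] at hc1 hc2 ⊢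
  have hK : ℵ₀ ≤ #K := hc0.trans hc1
  have hPK : #P ≤ 2 ^ #K := by rw [hPe]; exact (hpo.trans hc2).trans (cantor _).le
  have hinf : ℵ₀ ≤ (2 : Cardinal.{u}) ^ #K := hK.trans (cantor _).le
  have hpow : ((2 : Cardinal.{u}) ^ #K) ^ #K = 2 ^ #K := by
    rw [← power_mul, mul_eq_self hK]
  choose b hb hb' using base_enum (X := X) P hPe.ge
  obtain ⟨A, a, hA, hd⟩ := dens hqr K P hK hPK hc1 b hb hb'
  let n : A × P → Set X := fun q => b (a q.1) q.2
  have hn : ∀ O : Set X, IsOpen O → O.Nonempty → ∃ f : K → A × P,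
      closure (⋃ k, n (f k)) = closure O := by
    intro O hO hOn
    have dense' : ∀ U : Set X, IsOpen U → U.Nonempty → ∃ q, n q ⊆ U := by
      intro U hU hUn
      obtain ⟨i, hi⟩ := hd.exists_mem_open hU hUn
      obtain ⟨p, hp⟩ := hb' _ U hU hi
      exact ⟨(i, p), hp⟩
    obtain ⟨q0, hq0⟩ := dense' O hO hOn
    obtain ⟨f, hf⟩ := cell_enum K hc1 (J := {q // n q ⊆ O}) ⟨q0, hq0⟩ (fun q => n q.1)
      (fun q => (hb _ _).1)
    refine ⟨fun k => (f k).1, subset_antisymm ?_ ?_⟩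
    · exact closure_mono (iUnion_subset fun k => (f k).2)
    · refine closure_minimal (fun x hx => ?_) isClosed_closure
      by_contra hxc
      obtain ⟨q, hq⟩ := dense' (O \ closure (⋃ k, n (f k).1)) (hO.sdiff isClosed_closure)
        ⟨x, hx, hxc⟩
      obtain ⟨z, hz⟩ := (hb (a q.1) q.2).2
      exact (hq hz).2 (hf ⟨q, hq.trans sdiff_subset⟩ hz)
  have hT : Nonempty T := by
    rw [← mk_ne_zero_iff, hTe]; exact (aleph0_pos.trans_le ho0).ne'
  have hphi : ∀ x : X, ∃ φ : (T → P) → Option (K → A × P),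
      ∀ y, (∀ s g, φ s = some g → y ∈ closure (⋃ k, n (g k))) ↔ y = x := by
    intro x
    have h1 : ∀ s : T → P, ∃ g : K → A × P,
        closure (⋃ k, n (g k)) = closure (⋃ t, b x (s t)) := by
      intro s
      refine hn _ (isOpen_iUnion fun t => (hb _ _).1) ?_
      obtain ⟨z, hz⟩ := (hb x (s (Classical.arbitrary T))).2
      exact ⟨z, mem_iUnion.2 ⟨_, hz⟩⟩
    choose G hG using h1
    refine ⟨fun s => if x ∈ closure (⋃ t, b x (s t)) then some (G s) else none, fun y => ⟨?_, ?_⟩⟩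
    · intro h
      by_contra hyx
      obtain ⟨W, U, hW, hU, hyW, hxU, hWU⟩ := t2_separation hyx
      have hx : x ∈ closure (⋃₀ {B | ∃ p, b x p = B ∧ B ⊆ U}) := by
        rw [mem_closure_iff]
        intro O hO hxO
        obtain ⟨p, hp⟩ := hb' x (O ∩ U) (hO.inter hU) ⟨hxO, hxU⟩
        obtain ⟨z, hz⟩ := (hb x p).2
        exact ⟨z, (hp hz).1, b x p, ⟨p, rfl, hp.trans inter_subset_right⟩, hz⟩
      obtain ⟨𝒱, h𝒱, hcard, hx𝒱⟩ := ot_mem.2 x _ (by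
        rintro B ⟨p, rfl, -⟩
        exact (hb x p).1) hx
      obtain ⟨pd, hpd⟩ := hb' x U hU hxU
      have hj : ∀ B : 𝒱, ∃ p, b x p = B.1 ∧ B.1 ⊆ U := fun B => h𝒱 B.2
      choose j hj using hj
      obtain ⟨s, hs, hs'⟩ := enum_of_le (hcard.trans hTe.ge) j pd
      have hxs : x ∈ closure (⋃ t, b x (s t)) := by
        refine closure_mono ?_ hx𝒱
        refine sUnion_subset fun B hB => ?_
        obtain ⟨t, ht⟩ := hs ⟨B, hB⟩
        have : b x (s t) = B := by rw [ht]; exact (hj ⟨B, hB⟩).1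
        rw [← this]
        exact subset_iUnion (fun t => b x (s t)) t
      have hy := h s (G s) (if_pos hxs)
      rw [hG] at hy
      obtain ⟨z, hzW, hz⟩ := mem_closure_iff.1 hy W hW hyW
      obtain ⟨t, ht⟩ := mem_iUnion.1 hz
      have : b x (s t) ⊆ U := by
        rcases hs' t with h | ⟨B, h⟩
        · rw [h]; exact hpd
        · rw [h, (hj B).1]; exact (hj B).2
      exact disjoint_left.1 hWU hzW (this ht)
    · rintro rfl s g hg
      by_cases hxs : y ∈ closure (⋃ t, b y (s t))
      · simp only [hxs, if_true, Option.some.injEq] at hg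
        rw [← hg, hG]; exact hxs
      · simp [hxs] at hg
  choose φ hφ using hphi
  have hinj : Function.Injective φ := by
    intro x y hxy
    apply (hφ y x).1
    rw [← hxy]
    exact (hφ x x).2 rfl
  refine (mk_le_of_injective hinj).trans ?_
  have hAP : #(A × P) ≤ 2 ^ #K := by
    rw [mk_prod, lift_id, lift_id]
    exact (mul_le_mul' hA hPK).trans (mul_eq_self hinf).le
  have hO : #(Option (K → A × P)) ≤ 2 ^ #K := by
    rw [mk_option]
    refine add_le_of_le hinf ?_ (one_le_aleph0.trans hinf)
    rw [← hpow, ← power_def]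
    exact power_le_power_right hAP
  have hTP : #(T → P) ≤ #K := by
    rw [← power_def, hTe, hPe]; exact hc2
  rw [← power_def]
  calc _ ≤ ((2 : Cardinal.{u}) ^ #K) ^ #(T → P) := power_le_power_right hO
    _ ≤ ((2 : Cardinal.{u}) ^ #K) ^ #K :=
      power_le_power_left (aleph0_pos.trans_le hinf).ne' hTP
    _ = _ := hpow
end

section
/- Let X be a quasiregular Hausdorff topological space. Then |X| ≤ πχ(X)^{c(X)^{qψ(X)}} (iterated cardinal exponentiation). -/
open Set TopologicalSpace Cardinal

universe u

variable (X : Type u) [TopologicalSpace X]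

theorem cell_sub_s12 {X : Type u} [TopologicalSpace X] (G : Set (Set X)) (hG : ∀ U ∈ G, IsOpen U) :
    ∃ U ⊆ G, #U ≤ cellularity X ∧ ⋃₀ G ⊆ closure (⋃₀ U) := by
  classical
  have hc : cellularity X ∈ {κ : Cardinal.{u} | ℵ₀ ≤ κ ∧ ∀ 𝒰 : Set (Set X),
    (∀ U ∈ 𝒰, IsOpen U ∧ U.Nonempty) → (𝒰.Pairwise fun U V => U ∩ V = ∅) → #𝒰 ≤ κ} := by
    apply csInf_mem
    exact ⟨max ℵ₀ #(Set X), le_max_left _ _, fun 𝒰 _ _ => (mk_set_le 𝒰).trans (le_max_right _ _)⟩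
  let S : Set (Set (Set X)) := {D | (∀ U ∈ D, IsOpen U ∧ U.Nonempty ∧ ∃ V ∈ G, U ⊆ V) ∧
    D.Pairwise fun U V => U ∩ V = ∅}
  obtain ⟨M, hM⟩ : ∃ M, Maximal (fun D => D ∈ S) M := by
    apply zorn_subset
    intro c hcS hchain
    refine ⟨⋃₀ c, ⟨?_, ?_⟩, fun s hs => subset_sUnion_of_mem hs⟩
    · rintro U ⟨D, hD, hU⟩
      exact (hcS hD).1 U hU
    · rintro U ⟨D, hD, hU⟩ V ⟨E, hE, hV⟩ hne
      rcases hchain.total hD hE with h | h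
      · exact (hcS hE).2 (h hU) hV hne
      · exact (hcS hD).2 hU (h hV) hne
  have hMS := hM.1
  choose! f hfG hf using fun U (hU : U ∈ M) => (hMS.1 U hU).2.2
  refine ⟨f '' M, ?_, ?_, ?_⟩
  · rintro _ ⟨U, hU, rfl⟩
    exact hfG U hU
  · exact mk_image_le.trans (hc.2 M (fun U hU => ⟨(hMS.1 U hU).1, (hMS.1 U hU).2.1⟩) hMS.2)
  · rintro x ⟨V, hV, hx⟩
    rw [mem_closure_iff]
    intro O hO hxO
    by_contra hne
    have hdis : ∀ U ∈ M, (O ∩ V) ∩ U = ∅ := by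
      intro U hU
      by_contra h
      obtain ⟨y, hy, hyU⟩ := nonempty_iff_ne_empty.2 h
      exact hne ⟨y, hy.1, f U, ⟨U, hU, rfl⟩, hf U hU hyU⟩
    have hins : insert (O ∩ V) M ∈ S := by
      refine ⟨?_, ?_⟩
      · rintro U (rfl | hU)
        · exact ⟨hO.inter (hG V hV), ⟨x, hxO, hx⟩, V, hV, inter_subset_right⟩
        · exact hMS.1 U hU
      · apply hMS.2.insert
        intro U hU _
        exact ⟨hdis U hU, by rw [inter_comm]; exact hdis U hU⟩
    have hmem : O ∩ V ∈ M := hM.2 hins (subset_insert _ _) (mem_insert _ _)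
    have := hdis _ hmem
    rw [inter_self] at this
    have hxx : x ∈ O ∩ V := ⟨hxO, hx⟩
    rw [this] at hxx
    exact hxx

theorem aleph0_le_cell (X : Type u) [TopologicalSpace X] : ℵ₀ ≤ cellularity X := by
  have hc : cellularity X ∈ {κ : Cardinal.{u} | ℵ₀ ≤ κ ∧ ∀ 𝒰 : Set (Set X),
    (∀ U ∈ 𝒰, IsOpen U ∧ U.Nonempty) → (𝒰.Pairwise fun U V => U ∩ V = ∅) → #𝒰 ≤ κ} := by
    apply csInf_mem
    exact ⟨max ℵ₀ #(Set X), le_max_left _ _, fun 𝒰 _ _ => (mk_set_le 𝒰).trans (le_max_right _ _)⟩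
  exact hc.1

theorem surj_of_le {α : Type u} {P : Type u} (B : Set α) (hB : B.Nonempty) (h : #B ≤ #P) :
    ∃ g : P → α, range g = B := by
  obtain ⟨e⟩ := h
  have : Nonempty B := hB.to_subtype
  refine ⟨fun p => (Function.invFun e p : B), ?_⟩
  ext a
  constructor
  · rintro ⟨p, rfl⟩
    exact (Function.invFun e p).2
  · intro ha
    obtain ⟨p, hp⟩ := Function.invFun_surjective e.injective ⟨a, ha⟩
    exact ⟨p, by simp [hp]⟩

theorem piChar_spec (X : Type u) [TopologicalSpace X] (x : X) : ℵ₀ ≤ piChar X ∧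
    ∃ b : (piChar X).out → Set X, (∀ p, IsOpen (b p) ∧ (b p).Nonempty) ∧
      ∀ U, IsOpen U → x ∈ U → ∃ p, b p ⊆ U := by
  have hc : piCharAt X x ∈ {κ : Cardinal.{u} | ℵ₀ ≤ κ ∧ ∃ ℬ : Set (Set X),
    (∀ B ∈ ℬ, IsOpen B ∧ B.Nonempty) ∧
    (∀ U : Set X, IsOpen U → x ∈ U → ∃ B ∈ ℬ, B ⊆ U) ∧ #ℬ ≤ κ} := by
    apply csInf_mem
    exact ⟨max ℵ₀ #(Set X), le_max_left _ _, {U | IsOpen U ∧ U.Nonempty}, fun B hB => hB,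
      fun U hU hx => ⟨U, ⟨hU, x, hx⟩, subset_rfl⟩, (mk_set_le _).trans (le_max_right _ _)⟩
  have hle : piCharAt X x ≤ piChar X := le_ciSup Cardinal.bddAbove_of_small x
  obtain ⟨h0, B, hB, hB2, hB3⟩ := hc
  refine ⟨h0.trans hle, ?_⟩
  obtain ⟨g, rfl⟩ := surj_of_le (P := (piChar X).out) B
    (by obtain ⟨b, hb, _⟩ := hB2 univ isOpen_univ (mem_univ _); exact ⟨b, hb⟩)
    (by rw [mk_out]; exact hB3.trans hle)
  exact ⟨g, fun p => hB _ ⟨p, rfl⟩, fun U hU hx => by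
    obtain ⟨_, ⟨p, rfl⟩, h⟩ := hB2 U hU hx; exact ⟨p, h⟩⟩

theorem qPsi_spec (X : Type u) [TopologicalSpace X] [T2Space X] (x : X) : ℵ₀ ≤ qPsi X ∧
    ∃ B : Set (Set X), (∀ U ∈ B, IsOpen U ∧ U.Nonempty) ∧ #B ≤ qPsi X ∧
    ∀ y : X, y ≠ x → ∃ 𝒞 ⊆ B, x ∈ closure (⋃₀ 𝒞) ∧ y ∉ closure (⋃₀ 𝒞) := by
  have hc : qPsiAt X x ∈ {κ : Cardinal.{u} | ℵ₀ ≤ κ ∧ ∃ ℬ : Set (Set X),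
    (∀ B ∈ ℬ, IsOpen B ∧ B.Nonempty) ∧ #ℬ ≤ κ ∧
    ∀ y : X, y ≠ x → ∃ 𝒞 ⊆ ℬ, x ∈ closure (⋃₀ 𝒞) ∧ y ∉ closure (⋃₀ 𝒞)} := by
    apply csInf_mem
    refine ⟨max ℵ₀ #(Set X), le_max_left _ _, {U | IsOpen U ∧ U.Nonempty}, fun B hB => hB,
      (mk_set_le _).trans (le_max_right _ _), fun y hy => ?_⟩
    obtain ⟨u, v, hu, hv, hyu, hxv, hd⟩ := t2_separation hy
    refine ⟨{v}, by simpa using ⟨hv, x, hxv⟩, ?_, ?_⟩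
    · rw [sUnion_singleton]; exact subset_closure hxv
    · rw [sUnion_singleton]
      exact fun h => (hd.closure_right hu).le_bot ⟨hyu, h⟩
  have hle : qPsiAt X x ≤ qPsi X := le_ciSup Cardinal.bddAbove_of_small x
  obtain ⟨h0, B, hB, hB2, hB3⟩ := hc
  exact ⟨h0.trans hle, B, hB, hB2.trans hle, hB3⟩

def wB (C P : Type u) : Option (C → P) → Type u
  | none => PEmpty
  | some _ => C

def wEval {C P X : Type u} (x0 : X) (F : (C → X) → (C → P) → X) : WType (wB C P) → X
  | ⟨none, _⟩ => x0
  | ⟨some p, g⟩ => F (fun c => wEval x0 F (g c)) p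

theorem wcard (C P : Type u) (hC : ℵ₀ ≤ #C) (hP : ℵ₀ ≤ #P) : #(WType (wB C P)) ≤ #P ^ #C := by
  have hC0 : #C ≠ 0 := (aleph0_pos.trans_le hC).ne'
  have hl : ℵ₀ ≤ #P ^ #C := hP.trans (self_le_power _ (Cardinal.one_le_iff_ne_zero.2 hC0))
  apply WType.cardinalMk_le_of_le
  calc Cardinal.sum (fun a : Option (C → P) => (#P ^ #C) ^ #(wB C P a))
      ≤ Cardinal.sum (fun a : Option (C → P) => #P ^ #C) := by
        apply Cardinal.sum_le_sum
        rintro (_ | p)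
        · simp only [wB, mk_pempty, power_zero]; exact one_le_aleph0.trans hl
        · simp only [wB]; rw [← power_mul, mul_eq_self hC]
    _ ≤ #P ^ #C := by
        rw [sum_const', mk_option, ← power_def]
        rw [add_one_eq hl, mul_eq_self hl]

theorem exists_pibase (X : Type u) [TopologicalSpace X] [Nonempty X] (hqr : QuasiRegular X) :
    ∃ B : Set (Set X), (∀ U ∈ B, IsOpen U) ∧
      (∀ U, IsOpen U → U.Nonempty → ∃ V ∈ B, V.Nonempty ∧ V ⊆ U) ∧
      #B ≤ piChar X ^ cellularity X := by
  classical
  obtain ⟨x0⟩ := ‹Nonempty X›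
  have hP := (piChar_spec X x0).1
  have hC := aleph0_le_cell X
  choose b hb hb2 using fun x => (piChar_spec X x).2
  let P := (piChar X).out
  let C := (cellularity X).out
  have hF : ∃ F : (C → X) → (C → P) → X, ∀ (g : C → X) (p : C → P), closure (⋃ c, b (g c) (p c)) ≠ Set.univ →
      F g p ∉ closure (⋃ c, b (g c) (p c)) := by
    have : ∀ (g : C → X) (p : C → P), ∃ y, closure (⋃ c, b (g c) (p c)) ≠ Set.univ →
      y ∉ closure (⋃ c, b (g c) (p c)) := by
      intro g p
      by_cases h : closure (⋃ c, b (g c) (p c)) = Set.univ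
      · exact ⟨x0, fun h' => absurd h h'⟩
      · obtain ⟨y, hy⟩ := (ne_univ_iff_exists_notMem _).1 h
        exact ⟨y, fun _ => hy⟩
    choose F hF using this
    exact ⟨F, hF⟩
  obtain ⟨F, hF⟩ := hF
  let A : Set X := range (wEval x0 F)
  have hx0 : x0 ∈ A := ⟨WType.mk none (fun e => nomatch e), by simp [wEval]⟩
  have hAF : ∀ (g : C → X) (p : C → P), (∀ c, g c ∈ A) → F g p ∈ A := by
    intro g p hg
    choose w hw using hg
    refine ⟨WType.mk (some p) w, ?_⟩
    change F (fun c => wEval x0 F (w c)) p = F g p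
    congr 1
    funext c
    exact hw c
  have hA : Dense A := by
    by_contra hnd
    have hne : ((closure A)ᶜ).Nonempty := by
      rw [nonempty_compl]
      exact fun h => hnd (dense_iff_closure_eq.2 h)
    obtain ⟨V, hVo, hVn, hV⟩ := hqr _ isClosed_closure.isOpen_compl hne
    let G : Set (Set X) := {U | (∃ a ∈ A, ∃ p, U = b a p) ∧ U ⊆ (closure V)ᶜ}
    have hGA : A ⊆ closure (⋃₀ G) := by
      intro a ha
      rw [mem_closure_iff]
      intro O hO haO
      have : a ∈ (closure V)ᶜ := fun h => hV h (subset_closure ha)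
      obtain ⟨p, hp⟩ := hb2 a (O ∩ (closure V)ᶜ) (hO.inter isClosed_closure.isOpen_compl) ⟨haO, this⟩
      obtain ⟨y, hy⟩ := (hb a p).2
      exact ⟨y, (hp hy).1, b a p, ⟨⟨a, ha, p, rfl⟩, fun z hz => (hp hz).2⟩, hy⟩
    obtain ⟨U, hUG, hUc, hU⟩ := cell_sub_s12 G (by rintro _ ⟨⟨a, _, p, rfl⟩, _⟩; exact (hb a p).1)
    have hAU : A ⊆ closure (⋃₀ U) := hGA.trans (closure_minimal hU isClosed_closure)
    have hUne : U.Nonempty := by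
      rcases U.eq_empty_or_nonempty with rfl | h
      · have := hAU hx0
        simp at this
      · exact h
    obtain ⟨h, rfl⟩ := surj_of_le (P := C) U hUne (by rw [mk_out]; exact hUc)
    choose g hgA p hgp using fun c => (hUG ⟨c, rfl⟩ : h c ∈ G).1
    have heq : ⋃₀ range h = ⋃ c, b (g c) (p c) := by
      rw [sUnion_range]
      exact iUnion_congr hgp
    rw [heq] at hAU
    refine hF g p ?_ (hAU (hAF g p hgA))
    intro huniv
    obtain ⟨v, hv⟩ := hVn
    have hv' : v ∈ closure (⋃ c, b (g c) (p c)) := huniv ▸ mem_univ v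
    rw [mem_closure_iff] at hv'
    obtain ⟨y, hyV, hy⟩ := hv' V hVo hv
    rw [mem_iUnion] at hy
    obtain ⟨c, hc⟩ := hy
    exact (hUG ⟨c, rfl⟩ : h c ∈ G).2 (hgp c ▸ hc) (subset_closure hyV)
  have hcard : #A ≤ piChar X ^ cellularity X := by
    have := wcard C P (by simpa [C] using hC) (by simpa [P] using hP)
    rw [mk_out, mk_out] at this
    exact mk_range_le.trans this
  refine ⟨range (fun q : A × P => b q.1 q.2), ?_, ?_, ?_⟩
  · rintro _ ⟨q, rfl⟩
    exact (hb _ _).1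
  · intro U hU hUn
    obtain ⟨a, haU, haA⟩ := hA.inter_open_nonempty U hU hUn
    obtain ⟨p, hp⟩ := hb2 a U hU haU
    exact ⟨b a p, ⟨(⟨a, haA⟩, p), rfl⟩, (hb a p).2, hp⟩
  · have h1 : piChar X ≤ piChar X ^ cellularity X :=
      self_le_power _ (one_le_aleph0.trans hC)
    calc _ ≤ #(A × P) := mk_range_le
      _ = #A * piChar X := by rw [mk_prod, lift_id, lift_id, mk_out]
      _ ≤ (piChar X ^ cellularity X) * (piChar X ^ cellularity X) := mul_le_mul' hcard h1
      _ = _ := mul_eq_self (hP.trans h1)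

theorem card_RO (X : Type u) [TopologicalSpace X] [Nonempty X] (hqr : QuasiRegular X) :
    #{K : Set X | ∃ O, IsOpen O ∧ K = closure O} ≤ piChar X ^ cellularity X := by
  obtain ⟨B, hBo, hB, hBc⟩ := exists_pibase X hqr
  obtain ⟨x0⟩ := ‹Nonempty X›
  have hP := (piChar_spec X x0).1
  have hC := aleph0_le_cell X
  have hl : ℵ₀ ≤ piChar X ^ cellularity X :=
    hP.trans (self_le_power _ (one_le_aleph0.trans hC))
  let C := (cellularity X).out
  have hsub : {K : Set X | ∃ O, IsOpen O ∧ K = closure O} ⊆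
      range (fun h : C → (insert ∅ B : Set (Set X)) => closure (⋃ c, (h c : Set X))) := by
    rintro _ ⟨O, hO, rfl⟩
    let G : Set (Set X) := {U | U ∈ (insert ∅ B : Set (Set X)) ∧ U ⊆ O}
    have hGo : ∀ U ∈ G, IsOpen U := by
      rintro U ⟨rfl | hU, _⟩
      · exact isOpen_empty
      · exact hBo U hU
    have hOG : O ⊆ closure (⋃₀ G) := by
      intro x hx
      rw [mem_closure_iff]
      intro W hW hxW
      obtain ⟨V, hV, ⟨y, hy⟩, hVs⟩ := hB (W ∩ O) (hW.inter hO) ⟨x, hxW, hx⟩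
      exact ⟨y, (hVs hy).1, V, ⟨Or.inr hV, fun z hz => (hVs hz).2⟩, hy⟩
    obtain ⟨U, hUG, hUc, hU⟩ := cell_sub_s12 G hGo
    have hU' : #(insert ∅ U : Set (Set X)) ≤ #C := by
      rw [mk_out]
      exact (mk_insert_le).trans ((add_le_add hUc (one_le_aleph0.trans hC)).trans
        (add_eq_self hC).le)
    obtain ⟨h, hh⟩ := surj_of_le (P := C) (insert ∅ U) (insert_nonempty _ _) hU'
    have hhm : ∀ c, h c = ∅ ∨ h c ∈ U := fun c => by
      have : h c ∈ insert ∅ U := hh ▸ mem_range_self c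
      exact this
    refine ⟨fun c => ⟨h c, ?_⟩, ?_⟩
    · rcases hhm c with h | h
      · exact Or.inl h
      · exact (hUG h).1
    · have heq : (⋃ c, h c) = ⋃₀ U := by
        rw [← sUnion_range, hh, sUnion_insert, empty_union]
      simp only [heq]
      apply Subset.antisymm
      · exact closure_mono (sUnion_subset fun V hV => (hUG hV).2)
      · exact closure_minimal (hOG.trans (closure_minimal hU isClosed_closure)) isClosed_closure
  have hB' : #(insert ∅ B : Set (Set X)) ≤ piChar X ^ cellularity X :=
    (mk_insert_le).trans ((add_le_add hBc (one_le_aleph0.trans hl)).trans (add_eq_self hl).le)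
  calc _ ≤ _ := mk_le_mk_of_subset hsub
    _ ≤ #(C → (insert ∅ B : Set (Set X))) := mk_range_le
    _ = #(insert ∅ B : Set (Set X)) ^ cellularity X := by rw [← power_def, mk_out]
    _ ≤ (piChar X ^ cellularity X) ^ cellularity X := power_le_power_right hB'
    _ = _ := by rw [← power_mul, mul_eq_self hC]

theorem stmt_12 (X : Type u) [TopologicalSpace X] [T2Space X] (hqr : QuasiRegular X) :
    #X ≤ piChar X ^ (cellularity X ^ qPsi X) := by
  classical
  rcases isEmpty_or_nonempty X with hX | hX
  · simp
  have hR := card_RO X hqr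
  have hC := aleph0_le_cell X
  have hx0 := hX
  obtain ⟨x0⟩ := hx0
  have hP := (piChar_spec X x0).1
  have hQ := (qPsi_spec X x0).1
  set R := {K : Set X | ∃ O, IsOpen O ∧ K = closure O} with hRdef
  let T := (qPsi X).out
  choose B hBo hBc hB using fun x => (qPsi_spec X x).2
  have hB' : ∀ x, Nonempty (B x ↪ T) := fun x => by
    have : #(B x) ≤ #T := by rw [mk_out]; exact hBc x
    exact this
  let e := fun x => (hB' x).some
  let D : X → Set T → Set X := fun x s => closure (⋃₀ {U | ∃ h : U ∈ B x, e x ⟨U, h⟩ ∈ s})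
  have hDR : ∀ x s, D x s ∈ R := fun x s =>
    ⟨_, isOpen_sUnion (by rintro U ⟨h, _⟩; exact (hBo x U h).1), rfl⟩
  have hUR : (univ : Set X) ∈ R := ⟨univ, isOpen_univ, by simp⟩
  let f : X → Set T → R := fun x s => if x ∈ D x s then ⟨D x s, hDR x s⟩ else ⟨univ, hUR⟩
  have hmem : ∀ x s, x ∈ (f x s : Set X) := by
    intro x s
    by_cases h : x ∈ D x s
    · simp only [f, if_pos h]; exact h
    · simp only [f, if_neg h]; exact mem_univ _
  have hinj : Function.Injective f := by
    intro x y hxy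
    by_contra hne
    obtain ⟨c, hcB, hxc, hyc⟩ := hB x y (Ne.symm hne)
    let s : Set T := {t | ∃ U, ∃ h : U ∈ B x, U ∈ c ∧ e x ⟨U, h⟩ = t}
    have hs : {U | ∃ h : U ∈ B x, e x ⟨U, h⟩ ∈ s} = c := by
      ext U
      constructor
      · rintro ⟨h, U', h', hc', he⟩
        have := congrArg Subtype.val ((e x).injective he)
        simp only at this
        exact this ▸ hc'
      · intro hU
        exact ⟨hcB hU, U, hcB hU, hU, rfl⟩
    have hD : D x s = closure (⋃₀ c) := by simp only [D, hs]
    have hfx : (f x s : Set X) = closure (⋃₀ c) := by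
      have : x ∈ D x s := hD ▸ hxc
      simp only [f, if_pos this, hD]
    apply hyc
    rw [← hfx, hxy]
    exact hmem y s
  have hPC0 : piChar X ≠ 0 := (aleph0_pos.trans_le hP).ne'
  calc #X ≤ #(Set T → R) := mk_le_of_injective hinj
    _ = #R ^ ((2 : Cardinal.{u}) ^ qPsi X) := by rw [← power_def, mk_set, mk_out]
    _ ≤ (piChar X ^ cellularity X) ^ ((2 : Cardinal.{u}) ^ qPsi X) := power_le_power_right hR
    _ = piChar X ^ (cellularity X * (2 : Cardinal.{u}) ^ qPsi X) := by rw [← power_mul]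
    _ ≤ piChar X ^ (cellularity X ^ qPsi X) := by
      apply power_le_power_left hPC0
      have h1 : cellularity X ≤ cellularity X ^ qPsi X :=
        self_le_power _ (one_le_aleph0.trans hQ)
      have h2 : (2 : Cardinal.{u}) ^ qPsi X ≤ cellularity X ^ qPsi X :=
        power_le_power_right ((nat_lt_aleph0 2).le.trans hC)
      exact (mul_le_mul' h1 h2).trans (mul_eq_self (hC.trans h1)).le
end
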